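/- arXiv:2603.25554 — 3 statements merged into one kernel-verified Lean document; each statement's English description precedes it below -/
import Mathlib

section
/- With margin vectors a ∈ ℕ^m, b ∈ ℕ^n satisfying N = Σ a_i = Σ b_j, one has dim_ℂ SI(Q^p_{m,n}, 𝟏)_{θ_{a,b}} = dim_ℂ SI(𝒯, β̂)_{σ̂_{a,b}}, where 𝒯 is the three-level star quiver, β̂ is the dimension vector with β̂(x_i) = 1 for i ∈ [m], β̂(x_{m+ℓ}) = m for ℓ ∈ [p], β̂(x₀) = (p+1)m, β̂(y₀) = pm, β̂(y_j) = 1 for j ∈ [n], and σ̂_{a,b} is the weight with σ̂_{a,b}(x_i) = a_i for i ∈ [m], σ̂_{a,b}(x_{m+ℓ}) = N for ℓ ∈ [p], σ̂_{a,b}(x₀) = 0, σ̂_{a,b}(y₀) = −N, σ̂_{a,b}(y_j) = −b_j for j ∈ [n]. -/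
/-- A finite quiver: finite sets of vertices and arrows with tail and head maps. -/
structure FinQuiver where
  V : Type
  A : Type
  [instFinV : Fintype V]
  [instDecV : DecidableEq V]
  [instFinA : Fintype A]
  [instDecA : DecidableEq A]
  t : A → V
  h : A → V

attribute [instance] FinQuiver.instFinV FinQuiver.instDecV FinQuiver.instFinA FinQuiver.instDecA

/-- Coerce an `ℕ`-valued function (dimension vector) to a `ℤ`-valued one. -/
def natToInt {X : Type} (α : X → ℕ) : X → ℤ := fun x => (α x : ℤ)

namespace FinQuiver

variable (Q : FinQuiver)

/-- `Q` has an oriented cycle. -/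
def HasCycle : Prop :=
  ∃ k : ℕ, ∃ c : Fin (k + 1) → Q.A, ∀ i : Fin (k + 1), Q.h (c i) = Q.t (c (i + 1))

/-- `Q` is acyclic: it has no oriented cycles. -/
def Acyclic : Prop := ¬ Q.HasCycle

/-- Two vertices are adjacent if some arrow joins them (in either direction). -/
def Adj (u v : Q.V) : Prop :=
  ∃ a : Q.A, (Q.t a = u ∧ Q.h a = v) ∨ (Q.t a = v ∧ Q.h a = u)

/-- `Q` is connected as an undirected graph. -/
def Connected : Prop := ∀ u v : Q.V, Relation.ReflTransGen Q.Adj u v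

/-- The representation space `rep(Q, β)`. -/
def Rep (β : Q.V → ℕ) : Type :=
  ∀ a : Q.A, Matrix (Fin (β (Q.h a))) (Fin (β (Q.t a))) ℂ

/-- The group `GL(β) = ∏ₓ GL(β(x), ℂ)`. -/
def GLb (β : Q.V → ℕ) : Type :=
  ∀ x : Q.V, (Matrix (Fin (β x)) (Fin (β x)) ℂ)ˣ

/-- The action of `g⁻¹ ∈ GL(β)` on `W ∈ rep(Q,β)`: `(g⁻¹ · W)ₐ = g_{ha}⁻¹ Wₐ g_{ta}`. -/
noncomputable def invAct {β : Q.V → ℕ} (g : Q.GLb β) (W : Q.Rep β) : Q.Rep β :=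
  fun a => ((g (Q.h a))⁻¹).val * W a * (g (Q.t a)).val

/-- `f : rep(Q,β) → ℂ` is a polynomial function of the matrix entries. -/
def IsPolyFun {β : Q.V → ℕ} (f : Q.Rep β → ℂ) : Prop :=
  ∃ P : MvPolynomial ((a : Q.A) × (Fin (β (Q.h a)) × Fin (β (Q.t a)))) ℂ,
    ∀ W : Q.Rep β, f W = MvPolynomial.eval (fun i => W i.1 i.2.1 i.2.2) P

/-- The character `∏ₓ det(gₓ)^{σ(x)}` of `GL(β)` attached to an integral weight `σ`. -/
noncomputable def detWeight {β : Q.V → ℕ} (σ : Q.V → ℤ) (g : Q.GLb β) : ℂ :=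
  ∏ x : Q.V, (Matrix.det (g x).val) ^ (σ x)

/-- The space `SI(Q,β)_σ` of semi-invariants of weight `σ`: polynomial functions `f` on
`rep(Q,β)` with `f(g⁻¹ · W) = (∏ₓ det(gₓ)^{σ(x)}) f(W)` for all `g ∈ GL(β)`. -/
noncomputable def SIw (β : Q.V → ℕ) (σ : Q.V → ℤ) : Submodule ℂ (Q.Rep β → ℂ) where
  carrier := {f | Q.IsPolyFun f ∧
    ∀ (g : Q.GLb β) (W : Q.Rep β), f (Q.invAct g W) = Q.detWeight σ g * f W}
  add_mem' := by
    rintro f₁ f₂ ⟨⟨P₁, hP₁⟩, h₁⟩ ⟨⟨P₂, hP₂⟩, h₂⟩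
    refine ⟨⟨P₁ + P₂, fun W => ?_⟩, fun g W => ?_⟩
    · simp [Pi.add_apply, hP₁ W, hP₂ W]
    · simp only [Pi.add_apply, h₁ g W, h₂ g W]; ring
  zero_mem' := by
    refine ⟨⟨0, fun W => ?_⟩, fun g W => ?_⟩ <;> simp
  smul_mem' := by
    rintro c f ⟨⟨P, hP⟩, hf⟩
    refine ⟨⟨MvPolynomial.C c * P, fun W => ?_⟩, fun g W => ?_⟩
    · simp [Pi.smul_apply, hP W, smul_eq_mul]
    · simp only [Pi.smul_apply, hf g W, smul_eq_mul]; ring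

/-- The dimension of the weight space of semi-invariants `SI(Q,β)_σ`. -/
noncomputable def siDim (β : Q.V → ℕ) (σ : Q.V → ℤ) : ℕ :=
  Module.finrank ℂ (Q.SIw β σ)

/-- The Euler (Ringel) form of `Q`. -/
def euler (α γ : Q.V → ℤ) : ℤ :=
  (∑ x : Q.V, α x * γ x) - ∑ a : Q.A, α (Q.t a) * γ (Q.h a)

/-- The weight `⟨α, ·⟩ : x ↦ ⟨α, eₓ⟩` attached to a dimension vector `α`. -/
def weightOf (α : Q.V → ℕ) : Q.V → ℤ :=
  fun x => (α x : ℤ) - ∑ a : Q.A, (if Q.h a = x then (α (Q.t a) : ℤ) else 0)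

/-- `(α ∘ β)_Q := dim SI(Q,β)_{⟨α,·⟩}`. -/
noncomputable def circ (α β : Q.V → ℕ) : ℕ := Q.siDim β (Q.weightOf α)

/-- `φ` is a morphism of representations `V → W`. -/
def IsHom {α γ : Q.V → ℕ} (V : Q.Rep α) (W : Q.Rep γ)
    (φ : ∀ x : Q.V, Matrix (Fin (γ x)) (Fin (α x)) ℂ) : Prop :=
  ∀ a : Q.A, φ (Q.h a) * V a = W a * φ (Q.t a)

/-- The space `Hom_Q(V, W)` of morphisms of representations. -/
noncomputable def homSpace {α γ : Q.V → ℕ} (V : Q.Rep α) (W : Q.Rep γ) :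
    Submodule ℂ (∀ x : Q.V, Matrix (Fin (γ x)) (Fin (α x)) ℂ) where
  carrier := {φ | Q.IsHom V W φ}
  add_mem' := by
    intro φ ψ hφ hψ a
    simp only [Pi.add_apply, Matrix.add_mul, Matrix.mul_add, hφ a, hψ a]
  zero_mem' := by
    intro a
    simp
  smul_mem' := by
    intro c φ hφ a
    simp only [Pi.smul_apply, Matrix.smul_mul, Matrix.mul_smul, hφ a]

/-- A representation is Schur if its endomorphism algebra is one-dimensional. -/
def IsSchur {α : Q.V → ℕ} (V : Q.Rep α) : Prop :=
  Module.finrank ℂ (Q.homSpace V V) = 1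

/-- A quiver exceptional sequence of dimension vectors. -/
def IsExcSeq {Nn : ℕ} (ε : Fin Nn → (Q.V → ℕ)) : Prop :=
  (∀ i, Q.euler (natToInt (ε i)) (natToInt (ε i)) = 1 ∧ ∃ V : Q.Rep (ε i), Q.IsSchur V) ∧
  ∀ i j : Fin Nn, i < j →
    Q.euler (natToInt (ε i)) (natToInt (ε j)) ≤ 0 ∧ Q.circ (ε j) (ε i) ≠ 0

/-- The quiver `Q(ℰ)` attached to a sequence `ℰ = (ε₁,…,ε_N)` of dimension vectors:
vertices `1,…,N` and `−⟨εᵢ, εⱼ⟩` arrows from `i` to `j` for `i ≠ j`. -/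
def quiverOfSeq {Nn : ℕ} (ε : Fin Nn → (Q.V → ℕ)) : FinQuiver where
  V := Fin Nn
  A := (i : Fin Nn) × (j : Fin Nn) ×
        Fin (if i = j then 0 else (-(Q.euler (natToInt (ε i)) (natToInt (ε j)))).toNat)
  t := fun a => a.1
  h := fun a => a.2.1

end FinQuiver

/-- An isomorphism of quivers. -/
structure QuiverIso (Q₁ Q₂ : FinQuiver) where
  vEquiv : Q₁.V ≃ Q₂.V
  aEquiv : Q₁.A ≃ Q₂.A
  t_comm : ∀ a : Q₁.A, Q₂.t (aEquiv a) = vEquiv (Q₁.t a)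
  h_comm : ∀ a : Q₁.A, Q₂.h (aEquiv a) = vEquiv (Q₁.h a)

/-- The `p`-complete bipartite quiver `Q^p_{m,n}`: sources `x₁,…,x_m`, sinks `y₁,…,y_n`,
and `p` arrows from each `xᵢ` to each `yⱼ`. -/
def Qpmn (m n p : ℕ) : FinQuiver where
  V := Fin m ⊕ Fin n
  A := Fin m × Fin n × Fin p
  t := fun a => Sum.inl a.1
  h := fun a => Sum.inr a.2.1

/-- The number `T_{a,b}` of 3-way contingency tables of size `m × n × p` with the two
plane-sum margins fixed by `a` and `b`. -/
noncomputable def numTables (m n p : ℕ) (a : Fin m → ℕ) (b : Fin n → ℕ) : ℕ :=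
  Nat.card {x : Fin m × Fin n × Fin p → ℕ //
    (∀ i : Fin m, ∑ j : Fin n, ∑ k : Fin p, x (i, j, k) = a i) ∧
    (∀ j : Fin n, ∑ i : Fin m, ∑ k : Fin p, x (i, j, k) = b j)}

/-- The weight `θ_{a,b}` of `Q^p_{m,n}`. -/
def thetaAB {m n : ℕ} (a : Fin m → ℕ) (b : Fin n → ℕ) : Fin m ⊕ Fin n → ℤ :=
  Sum.elim (fun i => (a i : ℤ)) (fun j => -(b j : ℤ))

/-- The vertices of the quiver `𝒯`: sources `x₁,…,x_{m+p}`, middle vertices `x₀, y₀`,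
and sinks `y₁,…,y_n`. -/
inductive TVert (m p n : ℕ) : Type where
  | x : Fin (m + p) → TVert m p n
  | x0 : TVert m p n
  | y0 : TVert m p n
  | y : Fin n → TVert m p n
  deriving DecidableEq, Fintype

/-- The quiver `𝒯` with arrows `x_ℓ → x₀` (`ℓ ∈ [m+p]`), `x₀ → y₀`, `y₀ → y_j` (`j ∈ [n]`). -/
def Tquiv (m p n : ℕ) : FinQuiver where
  V := TVert m p n
  A := Fin (m + p) ⊕ Unit ⊕ Fin n
  t := Sum.elim (fun ℓ => TVert.x ℓ) (Sum.elim (fun _ => TVert.x0) (fun _ => TVert.y0))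
  h := Sum.elim (fun _ => TVert.x0) (Sum.elim (fun _ => TVert.y0) (fun j => TVert.y j))

/-- The dimension vector `δᵢ` of `𝒯`: value `p+1` at `x₀`, `p` at `y₀`, `1` at `xᵢ` and at
`x_{m+1},…,x_{m+p}`, and `0` elsewhere. -/
def deltaT (m p n : ℕ) (i : Fin m) : TVert m p n → ℕ
  | .x ℓ => if ℓ.val = i.val ∨ m ≤ ℓ.val then 1 else 0
  | .x0 => p + 1
  | .y0 => p
  | .y _ => 0

/-- The simple dimension vector `e_{y_j}` of `𝒯`. -/
def eyT (m p n : ℕ) (j : Fin n) : TVert m p n → ℕ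
  | .y j' => if j' = j then 1 else 0
  | _ => 0

/-- The sequence `ℰ = (δ₁, …, δ_m, e_{y₁}, …, e_{y_n})` of dimension vectors of `𝒯`. -/
def seqE (m p n : ℕ) : Fin (m + n) → (TVert m p n → ℕ) :=
  fun i => if h : i.val < m then deltaT m p n ⟨i.val, h⟩
    else eyT m p n ⟨i.val - m, by have := i.isLt; omega⟩

/-- The dimension vector `β̂` of `𝒯`. -/
def betaHat (m p n : ℕ) : TVert m p n → ℕ
  | .x ℓ => if ℓ.val < m then 1 else m
  | .x0 => (p + 1) * m
  | .y0 => p * m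
  | .y _ => 1

/-- The weight `σ̂_{a,b}` of `𝒯`. -/
def sigmaHat (m p n : ℕ) (a : Fin m → ℕ) (b : Fin n → ℕ) (N : ℕ) : TVert m p n → ℤ
  | .x ℓ => if h : ℓ.val < m then (a ⟨ℓ.val, h⟩ : ℤ) else (N : ℤ)
  | .x0 => 0
  | .y0 => -(N : ℤ)
  | .y j => -(b j : ℤ)



namespace TProof

section Poly
variable {Q : FinQuiver} {β : Q.V → ℕ}

lemma pf_const (c : ℂ) : Q.IsPolyFun (β := β) (fun _ => c) :=
  ⟨MvPolynomial.C c, fun W => by simp⟩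

lemma pf_coord (a : Q.A) (r : Fin (β (Q.h a))) (c : Fin (β (Q.t a))) :
    Q.IsPolyFun (β := β) (fun W => W a r c) :=
  ⟨MvPolynomial.X ⟨a, r, c⟩, fun W => by simp⟩

lemma pf_add {f g : Q.Rep β → ℂ} (hf : Q.IsPolyFun f) (hg : Q.IsPolyFun g) :
    Q.IsPolyFun (fun W => f W + g W) := by
  obtain ⟨P, hP⟩ := hf
  obtain ⟨R, hR⟩ := hg
  exact ⟨P + R, fun W => by simp [hP, hR]⟩

lemma pf_mul {f g : Q.Rep β → ℂ} (hf : Q.IsPolyFun f) (hg : Q.IsPolyFun g) :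
    Q.IsPolyFun (fun W => f W * g W) := by
  obtain ⟨P, hP⟩ := hf
  obtain ⟨R, hR⟩ := hg
  exact ⟨P * R, fun W => by simp [hP, hR]⟩

lemma pf_sum {ι : Type*} (s : Finset ι) {f : ι → Q.Rep β → ℂ}
    (hf : ∀ i, Q.IsPolyFun (f i)) : Q.IsPolyFun (fun W => ∑ i ∈ s, f i W) := by
  choose P hP using hf
  exact ⟨∑ i ∈ s, P i, fun W => by simp [hP, map_sum]⟩

lemma pf_prod {ι : Type*} (s : Finset ι) {f : ι → Q.Rep β → ℂ}
    (hf : ∀ i, Q.IsPolyFun (f i)) : Q.IsPolyFun (fun W => ∏ i ∈ s, f i W) := by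
  choose P hP using hf
  exact ⟨∏ i ∈ s, P i, fun W => by simp [hP, map_prod]⟩

lemma pf_det {ι : Type*} [Fintype ι] [DecidableEq ι] {M : Q.Rep β → Matrix ι ι ℂ}
    (hM : ∀ i j, Q.IsPolyFun (fun W => M W i j)) : Q.IsPolyFun (fun W => (M W).det) := by
  simp only [Matrix.det_apply']
  exact pf_sum _ fun σ => pf_mul (pf_const _) (pf_prod _ fun i => hM _ _)

lemma pf_matmul {ι κ l : Type*} [Fintype κ] {M : Q.Rep β → Matrix ι κ ℂ}
    {M' : Q.Rep β → Matrix κ l ℂ}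
    (hM : ∀ i j, Q.IsPolyFun (fun W => M W i j))
    (hM' : ∀ i j, Q.IsPolyFun (fun W => M' W i j)) (i : ι) (j : l) :
    Q.IsPolyFun (fun W => (M W * M' W) i j) := by
  simp only [Matrix.mul_apply]
  exact pf_sum _ fun k => pf_mul (hM _ _) (hM' _ _)

lemma pf_adj {ι : Type*} [Fintype ι] [DecidableEq ι] {M : Q.Rep β → Matrix ι ι ℂ}
    (hM : ∀ i j, Q.IsPolyFun (fun W => M W i j)) (i j : ι) :
    Q.IsPolyFun (fun W => (M W).adjugate i j) := by
  simp only [Matrix.adjugate_apply]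
  refine pf_det fun k l => ?_
  by_cases h : k = j
  · subst h
    simpa [Matrix.updateRow_self] using pf_const _
  · simpa [Matrix.updateRow_ne h] using hM k l

lemma pf_comp {Q' : FinQuiver} {β' : Q'.V → ℕ} {f : Q'.Rep β' → ℂ} (hf : Q'.IsPolyFun f)
    {φ : Q.Rep β → Q'.Rep β'} (hφ : ∀ a r c, Q.IsPolyFun (fun W => φ W a r c)) :
    Q.IsPolyFun (fun W => f (φ W)) := by
  obtain ⟨P, hP⟩ := hf
  choose R hR using hφ
  refine ⟨MvPolynomial.bind₁ (fun i => R i.1 i.2.1 i.2.2) P, fun W => ?_⟩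
  refine (hP (φ W)).trans ?_
  rw [← MvPolynomial.aeval_eq_eval, ← MvPolynomial.aeval_eq_eval, MvPolynomial.aeval_bind₁]
  congr 2
  funext i
  exact hR i.1 i.2.1 i.2.2 W

/-- density -/
lemma pf_dense {f q : Q.Rep β → ℂ} (hf : Q.IsPolyFun f) (hq : Q.IsPolyFun q)
    (W₀ : Q.Rep β) (h0 : q W₀ ≠ 0) (h : ∀ W, q W ≠ 0 → f W = 0) : f = 0 := by
  obtain ⟨P, hP⟩ := hf
  obtain ⟨R, hR⟩ := hq
  have hPR : P * R = 0 := by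
    apply MvPolynomial.funext
    intro x
    let W₁ : Q.Rep β := fun a => Matrix.of fun r c => x ⟨a, r, c⟩
    have h1 : f W₁ = MvPolynomial.eval x P := hP W₁
    have h2 : q W₁ = MvPolynomial.eval x R := hR W₁
    have := h W₁
    rw [h1, h2] at this
    simp only [map_mul, map_zero, mul_eq_zero]
    by_contra hh
    push Not at hh
    exact hh.1 (this hh.2)
  rcases mul_eq_zero.mp hPR with h' | h'
  · funext W
    simp [hP, h']
  · exact absurd (by simp [hR, h']) h0

end Poly

section Model
variable {m n p : ℕ}

abbrev PI (m p : ℕ) : Type := Fin m × Fin p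
abbrev KI (m p : ℕ) : Type := Fin m ⊕ PI m p

abbrev TRep (m n p : ℕ) : Type := (Tquiv m p n).Rep (betaHat m p n)
abbrev TGL (m n p : ℕ) : Type := (Tquiv m p n).GLb (betaHat m p n)
abbrev QRep (m n p : ℕ) : Type := (Qpmn m n p).Rep (fun _ => 1)
abbrev QGL (m n p : ℕ) : Type := (Qpmn m n p).GLb (fun _ => 1)

def ex (n : ℕ) (i : Fin m) : Fin (betaHat m p n (.x (Fin.castAdd p i))) ≃ Unit :=
  (finCongr (by simp [betaHat])).trans (finOneEquiv.trans (Equiv.refl _))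

def eu (n : ℕ) (k : Fin p) : Fin (betaHat m p n (.x (Fin.natAdd m k))) ≃ Fin m :=
  finCongr (by simp [betaHat])

noncomputable def eX (m p n : ℕ) : Fin (betaHat m p n .x0) ≃ KI m p :=
  (Fintype.equivFinOfCardEq (by simp [betaHat]; ring)).symm

noncomputable def eY (m p n : ℕ) : Fin (betaHat m p n .y0) ≃ PI m p :=
  (Fintype.equivFinOfCardEq (by simp [betaHat]; ring)).symm

def gAt (g : TGL m n p) (v : TVert m p n) :
    (Matrix (Fin (betaHat m p n v)) (Fin (betaHat m p n v)) ℂ)ˣ := g v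

def wX (W : TRep m n p) (l : Fin (m + p)) :
    Matrix (Fin (betaHat m p n .x0)) (Fin (betaHat m p n (.x l))) ℂ := W (Sum.inl l)

def wA (W : TRep m n p) :
    Matrix (Fin (betaHat m p n .y0)) (Fin (betaHat m p n .x0)) ℂ := W (Sum.inr (Sum.inl ()))

def wY (W : TRep m n p) (j : Fin n) :
    Matrix (Fin 1) (Fin (betaHat m p n .y0)) ℂ := W (Sum.inr (Sum.inr j))

def gS (g : TGL m n p) (j : Fin n) : (Matrix (Fin 1) (Fin 1) ℂ)ˣ := g (.y j)

lemma wX_act (g : TGL m n p) (W : TRep m n p) (l : Fin (m + p)) :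
    wX ((Tquiv m p n).invAct g W) l =
      ((gAt g .x0)⁻¹).val * wX W l * (gAt g (.x l)).val := rfl

lemma wA_act (g : TGL m n p) (W : TRep m n p) :
    wA ((Tquiv m p n).invAct g W) =
      ((gAt g .y0)⁻¹).val * wA W * (gAt g .x0).val := rfl

lemma wY_act (g : TGL m n p) (W : TRep m n p) (j : Fin n) :
    wY ((Tquiv m p n).invAct g W) j =
      ((gS g j)⁻¹).val * wY W j * (gAt g .y0).val := rfl

lemma rep_ext {W W' : TRep m n p} (h1 : ∀ l, wX W l = wX W' l) (h2 : wA W = wA W')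
    (h3 : ∀ j, wY W j = wY W' j) : W = W' := by
  funext a
  rcases a with l | u | j
  · exact h1 l
  · exact h2
  · exact h3 j

/-- reindexed `X` block -/
noncomputable def mX (W : TRep m n p) : Matrix (KI m p) (KI m p) ℂ :=
  Matrix.of fun q => Sum.elim (fun i => wX W (Fin.castAdd p i) ((eX m p n).symm q) ((ex n i).symm ()))
    (fun ck => wX W (Fin.natAdd m ck.2) ((eX m p n).symm q) ((eu n ck.2).symm ck.1))

noncomputable def mA (W : TRep m n p) : Matrix (PI m p) (KI m p) ℂ :=
  (wA W).submatrix (eY m p n).symm (eX m p n).symm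

noncomputable def mY (W : TRep m n p) : Matrix (Fin n) (PI m p) ℂ :=
  Matrix.of fun j r => wY W j 0 ((eY m p n).symm r)

lemma mod_ext {W W' : TRep m n p} (h1 : mX W = mX W') (h2 : mA W = mA W')
    (h3 : mY W = mY W') : W = W' := by
  refine rep_ext (fun l => ?_) ?_ (fun j => ?_)
  · ext r c
    induction l using Fin.addCases with
    | left i =>
      have := congrFun (congrFun h1 (eX m p n r)) (Sum.inl i)
      obtain ⟨u, rfl⟩ := (ex n i).symm.surjective c
      simpa [mX] using this
    | right k =>
      obtain ⟨u, rfl⟩ := (eu n k).symm.surjective c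
      have := congrFun (congrFun h1 (eX m p n r)) (Sum.inr (u, k))
      simpa [mX] using this
  · ext r c
    have := congrFun (congrFun h2 (eY m p n r)) (eX m p n c)
    simpa [mA] using this
  · ext r c
    have := congrFun (congrFun h3 j) (eY m p n c)
    rw [Subsingleton.elim r 0]
    simpa [mY] using this

/-- inverse of the model map -/
noncomputable def ofMod (X : Matrix (KI m p) (KI m p) ℂ) (A : Matrix (PI m p) (KI m p) ℂ)
    (Y : Matrix (Fin n) (PI m p) ℂ) : TRep m n p := fun a =>
  match a with
  | Sum.inl l => show Matrix (Fin (betaHat m p n .x0)) (Fin (betaHat m p n (.x l))) ℂ from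
      Matrix.of fun r => Fin.addCases
        (motive := fun l => Fin (betaHat m p n (.x l)) → ℂ)
        (fun i _ => X (eX m p n r) (Sum.inl i))
        (fun k c => X (eX m p n r) (Sum.inr (eu n k c, k))) l
  | Sum.inr (Sum.inl _) => show Matrix (Fin (betaHat m p n .y0)) (Fin (betaHat m p n .x0)) ℂ from
      A.submatrix (eY m p n) (eX m p n)
  | Sum.inr (Sum.inr j) => show Matrix (Fin 1) (Fin (betaHat m p n .y0)) ℂ from
      Matrix.of fun _ c => Y j (eY m p n c)

lemma wX_ofMod_left (X : Matrix (KI m p) (KI m p) ℂ) (A : Matrix (PI m p) (KI m p) ℂ)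
    (Y : Matrix (Fin n) (PI m p) ℂ) (i r c) :
    wX (ofMod X A Y) (Fin.castAdd p i) r c = X (eX m p n r) (Sum.inl i) := by
  simp [wX, ofMod]

lemma wX_ofMod_right (X : Matrix (KI m p) (KI m p) ℂ) (A : Matrix (PI m p) (KI m p) ℂ)
    (Y : Matrix (Fin n) (PI m p) ℂ) (k r c) :
    wX (ofMod X A Y) (Fin.natAdd m k) r c = X (eX m p n r) (Sum.inr (eu n k c, k)) := by
  simp [wX, ofMod]

lemma mX_ofMod (X : Matrix (KI m p) (KI m p) ℂ) (A : Matrix (PI m p) (KI m p) ℂ)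
    (Y : Matrix (Fin n) (PI m p) ℂ) : mX (ofMod X A Y) = X := by
  ext q (i | ⟨c, k⟩)
  · simp [mX, wX_ofMod_left]
  · simp [mX, wX_ofMod_right]

lemma mA_ofMod (X : Matrix (KI m p) (KI m p) ℂ) (A : Matrix (PI m p) (KI m p) ℂ)
    (Y : Matrix (Fin n) (PI m p) ℂ) : mA (ofMod X A Y) = A := by
  ext q c
  simp [mA, wA, ofMod]

lemma mY_ofMod (X : Matrix (KI m p) (KI m p) ℂ) (A : Matrix (PI m p) (KI m p) ℂ)
    (Y : Matrix (Fin n) (PI m p) ℂ) : mY (ofMod X A Y) = Y := by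
  ext q c
  simp [mY, wY, ofMod]

/-- group data -/
def gt (g : TGL m n p) (i : Fin m) : ℂ :=
  (gAt g (.x (Fin.castAdd p i))).val ((ex n i).symm ()) ((ex n i).symm ())

def reU {ι κ : Type} [Fintype ι] [Fintype κ] [DecidableEq ι] [DecidableEq κ] (e : ι ≃ κ) :
    (Matrix ι ι ℂ)ˣ ≃* (Matrix κ κ ℂ)ˣ :=
  Units.mapEquiv (Matrix.reindexAlgEquiv ℂ ℂ e).toMulEquiv

lemma reU_val {ι κ : Type} [Fintype ι] [Fintype κ] [DecidableEq ι] [DecidableEq κ] (e : ι ≃ κ)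
    (u : (Matrix ι ι ℂ)ˣ) : (reU e u).val = u.val.submatrix e.symm e.symm := rfl

lemma reU_inv_val {ι κ : Type} [Fintype ι] [Fintype κ] [DecidableEq ι] [DecidableEq κ] (e : ι ≃ κ)
    (u : (Matrix ι ι ℂ)ˣ) : ((reU e u)⁻¹).val = (u⁻¹).val.submatrix e.symm e.symm := rfl

lemma reU_det {ι κ : Type} [Fintype ι] [Fintype κ] [DecidableEq ι] [DecidableEq κ] (e : ι ≃ κ)
    (u : (Matrix ι ι ℂ)ˣ) : (reU e u).val.det = u.val.det := by
  rw [reU_val, Matrix.det_submatrix_equiv_self]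

def gh (g : TGL m n p) (k : Fin p) : (Matrix (Fin m) (Fin m) ℂ)ˣ :=
  reU (eu n k) (gAt g (.x (Fin.natAdd m k)))

noncomputable def gX (g : TGL m n p) : (Matrix (KI m p) (KI m p) ℂ)ˣ := reU (eX m p n) (gAt g .x0)

noncomputable def gY (g : TGL m n p) : (Matrix (PI m p) (PI m p) ℂ)ˣ := reU (eY m p n) (gAt g .y0)

def gs (g : TGL m n p) (j : Fin n) : ℂ := (gS g j).val 0 0

def u1 (c : ℂˣ) : (Matrix (Fin 1) (Fin 1) ℂ)ˣ :=
  Units.map (Matrix.scalar (Fin 1)).toMonoidHom c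

lemma u1_apply (c : ℂˣ) : (u1 c).val 0 0 = c := by
  simp [u1]

lemma u1_inv (u : (Matrix (Fin 1) (Fin 1) ℂ)ˣ) : (u⁻¹).val 0 0 = (u.val 0 0)⁻¹ := by
  have h := congrFun (congrFun u.inv_mul 0) 0
  simp only [Matrix.mul_apply, Finset.univ_unique, Finset.sum_singleton, Fin.default_eq_zero,
    Matrix.one_apply_eq] at h
  exact eq_inv_of_mul_eq_one_left h

lemma exists_g (t : Fin m → ℂˣ) (h : Fin p → (Matrix (Fin m) (Fin m) ℂ)ˣ)
    (γ : (Matrix (KI m p) (KI m p) ℂ)ˣ) (κ : (Matrix (PI m p) (PI m p) ℂ)ˣ) (s : Fin n → ℂˣ) :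
    ∃ g : TGL m n p, (∀ i, gt g i = t i) ∧ gh g = h ∧ gX g = γ ∧ gY g = κ ∧ ∀ j, gs g j = s j := by
  let g : ∀ v : TVert m p n, (Matrix (Fin (betaHat m p n v)) (Fin (betaHat m p n v)) ℂ)ˣ :=
    fun v => match v with
    | .x l => Fin.addCases
        (motive := fun l => (Matrix (Fin (betaHat m p n (.x l))) (Fin (betaHat m p n (.x l))) ℂ)ˣ)
        (fun i => Units.map (Matrix.scalar _).toMonoidHom (t i))
        (fun k => (reU (eu n k)).symm (h k)) l
    | .x0 => (reU (eX m p n)).symm γ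
    | .y0 => (reU (eY m p n)).symm κ
    | .y j => u1 (s j)
  refine ⟨g, ?_, ?_, ?_, ?_, ?_⟩
  · intro i
    simp [gt, gAt, g]
  · funext k
    simp [gh, gAt, g]
  · simp [gX, gAt, g]
  · simp [gY, gAt, g]
  · intro j
    exact u1_apply _

noncomputable def gD (g : TGL m n p) : Matrix (KI m p) (KI m p) ℂ :=
  Matrix.fromBlocks (Matrix.diagonal (gt g)) 0 0 (Matrix.blockDiagonal fun k => (gh g k).val)

lemma mX_act (g : TGL m n p) (W : TRep m n p) :
    mX ((Tquiv m p n).invAct g W) = ((gX g)⁻¹).val * mX W * gD g := by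
  have key : ∀ (l : Fin (m + p)) (q : KI m p) (c : Fin (betaHat m p n (.x l))),
      (((gAt g .x0)⁻¹).val * wX W l) ((eX m p n).symm q) c =
        ∑ q', ((gX g)⁻¹).val q q' * wX W l ((eX m p n).symm q') c := by
    intro l q c
    rw [Matrix.mul_apply, ← (eX m p n).symm.sum_comp]
    rfl
  ext q (i | ⟨c, k⟩)
  · rw [Matrix.mul_apply, Fintype.sum_sum_type]
    simp only [gD, Matrix.fromBlocks_apply₁₁, Matrix.fromBlocks_apply₂₁, Matrix.zero_apply,
      mul_zero, Finset.sum_const_zero, add_zero, Matrix.diagonal_apply, mul_ite,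
      Finset.sum_ite_eq', Finset.mem_univ, if_true]
    simp only [mX, Matrix.of_apply, Sum.elim_inl, wX_act]
    rw [Matrix.mul_apply, ← (ex n i).symm.sum_comp]
    simp only [Finset.univ_unique, Finset.sum_singleton, key]
    rfl
  · rw [Matrix.mul_apply, Fintype.sum_sum_type]
    simp only [gD, Matrix.fromBlocks_apply₁₂, Matrix.fromBlocks_apply₂₂, Matrix.zero_apply,
      mul_zero, Finset.sum_const_zero, zero_add, Matrix.blockDiagonal_apply, mul_ite,
      Fintype.sum_prod_type, Finset.sum_ite_eq', Finset.mem_univ, if_true]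
    simp only [mX, Matrix.of_apply, Sum.elim_inr, wX_act]
    rw [Matrix.mul_apply, ← (eu n k).symm.sum_comp]
    simp only [key]
    rfl

lemma mA_act (g : TGL m n p) (W : TRep m n p) :
    mA ((Tquiv m p n).invAct g W) = ((gY g)⁻¹).val * mA W * (gX g).val := by
  simp only [mA, wA_act, gX, gY, reU_inv_val, reU_val, Matrix.submatrix_mul_equiv]

lemma mY_act (g : TGL m n p) (W : TRep m n p) :
    mY ((Tquiv m p n).invAct g W) =
      Matrix.diagonal (fun j => (gs g j)⁻¹) * mY W * (gY g).val := by
  ext j r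
  rw [Matrix.mul_apply]
  simp only [Matrix.diagonal_mul]
  simp only [mY, Matrix.of_apply, wY_act]
  rw [Matrix.mul_apply, ← (eY m p n).symm.sum_comp]
  simp only [Matrix.mul_apply, Finset.univ_unique, Finset.sum_singleton, Fin.default_eq_zero]
  rw [u1_inv]
  rfl

def qz (z : QRep m n p) (i : Fin m) (j : Fin n) (k : Fin p) : ℂ :=
  (show Matrix (Fin 1) (Fin 1) ℂ from z (i, j, k)) 0 0

def gq (g : QGL m n p) (v : Fin m ⊕ Fin n) : (Matrix (Fin 1) (Fin 1) ℂ)ˣ := g v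

lemma q_ext {z z' : QRep m n p} (h : ∀ i j k, qz z i j k = qz z' i j k) : z = z' := by
  funext ⟨i, j, k⟩
  have := h i j k
  apply Matrix.ext
  intro (r : Fin 1) (c : Fin 1)
  rw [Subsingleton.elim r 0, Subsingleton.elim c 0]
  exact this

lemma qz_act (g : QGL m n p) (z : QRep m n p) (i j k) :
    qz ((Qpmn m n p).invAct g z) i j k =
      ((gq g (Sum.inr j)).val 0 0)⁻¹ * qz z i j k * (gq g (Sum.inl i)).val 0 0 := by
  rw [← u1_inv]
  have : qz ((Qpmn m n p).invAct g z) i j k = (((gq g (Sum.inr j))⁻¹).val *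
    (show Matrix (Fin 1) (Fin 1) ℂ from z (i, j, k)) * (gq g (Sum.inl i)).val) 0 0 := rfl
  rw [this]
  simp only [Matrix.mul_apply, Finset.univ_unique, Finset.sum_singleton, Fin.default_eq_zero]
  rfl

lemma detWeight_Q (g : QGL m n p) (a : Fin m → ℕ) (b : Fin n → ℕ) :
    (Qpmn m n p).detWeight (thetaAB a b) g =
      (∏ i, (gq g (Sum.inl i)).val 0 0 ^ a i) * ∏ j, ((gq g (Sum.inr j)).val 0 0 ^ b j)⁻¹ := by
  have : (Qpmn m n p).detWeight (thetaAB a b) g =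
    ∏ v : Fin m ⊕ Fin n, ((gq g v).val.det) ^ (thetaAB a b v) := rfl
  rw [this, Fintype.prod_sum_type]
  simp [thetaAB]

def vEquiv (m p n : ℕ) : (Fin (m + p) ⊕ Fin n) ⊕ (Unit ⊕ Unit) ≃ TVert m p n where
  toFun := Sum.elim (Sum.elim .x .y) (Sum.elim (fun _ => .x0) (fun _ => .y0))
  invFun v := match v with
    | .x l => Sum.inl (Sum.inl l)
    | .y l => Sum.inl (Sum.inr l)
    | .x0 => Sum.inr (Sum.inl ())
    | .y0 => Sum.inr (Sum.inr ())
  left_inv := by rintro ((l | l) | (l | l)) <;> rfl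
  right_inv := by rintro (l | _ | _ | l) <;> rfl

def dg (g : TGL m n p) (v : TVert m p n) : ℂ := (gAt g v).val.det

lemma detWeight_T (g : TGL m n p) (a : Fin m → ℕ) (b : Fin n → ℕ) (N : ℕ) :
    (Tquiv m p n).detWeight (sigmaHat m p n a b N) g =
      (∏ i, gt g i ^ a i) * (∏ k, (gh g k).val.det) ^ N * ((gY g).val.det ^ N)⁻¹ *
        ∏ j, (gs g j ^ b j)⁻¹ := by
  have : (Tquiv m p n).detWeight (sigmaHat m p n a b N) g =
    ∏ v : TVert m p n, dg g v ^ (sigmaHat m p n a b N v) := rfl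
  rw [this, ← (vEquiv m p n).prod_comp]
  simp only [Fintype.prod_sum_type, Fin.prod_univ_add]
  have h1 : ∀ i : Fin m, dg g (.x (Fin.castAdd p i)) = gt g i := by
    intro i
    rw [dg, ← reU_det (ex n i)]
    simp only [reU_val, Matrix.det_unique]
    rfl
  have h2 : ∀ k : Fin p, dg g (.x (Fin.natAdd m k)) = (gh g k).val.det := by
    intro k
    rw [dg, gh, reU_det]
  have h3 : dg g .y0 = (gY g).val.det := by
    rw [dg, gY, reU_det]
  have h4 : ∀ j : Fin n, dg g (.y j) = gs g j := by
    intro j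
    exact Matrix.det_fin_one (gS g j).val
  simp only [vEquiv, Equiv.coe_fn_mk, Sum.elim_inl, Sum.elim_inr, h1, h2, h3, h4]
  simp [sigmaHat, Finset.prod_pow]
  ring

/-- The blocks of `B = A X`. -/
noncomputable def B0 (W : TRep m n p) : Matrix (PI m p) (Fin m) ℂ := (mA W * mX W).toCols₁
noncomputable def mC (W : TRep m n p) : Matrix (PI m p) (PI m p) ℂ := (mA W * mX W).toCols₂

noncomputable def hD (g : TGL m n p) : Matrix (PI m p) (PI m p) ℂ :=
  Matrix.blockDiagonal fun k => (gh g k).val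

lemma B_eq (W : TRep m n p) : mA W * mX W = Matrix.fromCols (B0 W) (mC W) :=
  (Matrix.fromCols_toCols _).symm

lemma B_act (g : TGL m n p) (W : TRep m n p) :
    mA ((Tquiv m p n).invAct g W) * mX ((Tquiv m p n).invAct g W) =
      Matrix.fromCols (((gY g)⁻¹).val * B0 W * Matrix.diagonal (gt g))
        (((gY g)⁻¹).val * mC W * hD g) := by
  have : mA ((Tquiv m p n).invAct g W) * mX ((Tquiv m p n).invAct g W) =
      ((gY g)⁻¹).val * (mA W * mX W) * gD g := by
    rw [mX_act, mA_act]
    simp only [Matrix.mul_assoc]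
    rw [← Matrix.mul_assoc (gX g).val, Units.mul_inv, Matrix.one_mul]
  rw [this, B_eq, gD, Matrix.mul_fromCols, Matrix.fromCols_mul_fromBlocks]
  simp [hD]

lemma B0_act (g : TGL m n p) (W : TRep m n p) :
    B0 ((Tquiv m p n).invAct g W) = ((gY g)⁻¹).val * B0 W * Matrix.diagonal (gt g) := by
  rw [B0, B_act, Matrix.toCols₁_fromCols]

lemma mC_act (g : TGL m n p) (W : TRep m n p) :
    mC ((Tquiv m p n).invAct g W) = ((gY g)⁻¹).val * mC W * hD g := by
  rw [mC, B_act, Matrix.toCols₂_fromCols]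

noncomputable def Ek (m : ℕ) {p : ℕ} (k : Fin p) : Matrix (PI m p) (PI m p) ℂ :=
  Matrix.blockDiagonal (Pi.single k 1)

noncomputable def zk (W : TRep m n p) (k : Fin p) : Matrix (Fin n) (Fin m) ℂ :=
  mY W * (mC W * Ek m k * (mC W).adjugate) * B0 W

lemma hD_comm (g : TGL m n p) (k : Fin p) : hD g * Ek m k = Ek m k * hD g := by
  rw [hD, Ek, ← Matrix.blockDiagonal_mul, ← Matrix.blockDiagonal_mul]
  congr 1
  funext l
  by_cases h : l = k
  · subst h; simp
  · simp [h]

lemma zk_act (g : TGL m n p) (W : TRep m n p) (k : Fin p) :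
    zk ((Tquiv m p n).invAct g W) k =
      ((∏ k, (gh g k).val.det) * ((gY g).val.det)⁻¹) •
        (Matrix.diagonal (fun j => (gs g j)⁻¹) * zk W k * Matrix.diagonal (gt g)) := by
  have hd : (hD g).det = ∏ k, (gh g k).val.det := by rw [hD, Matrix.det_blockDiagonal]
  have hk : (((gY g)⁻¹).val).det = ((gY g).val.det)⁻¹ := by
    apply eq_inv_of_mul_eq_one_left
    rw [← Matrix.det_mul, Units.inv_mul, Matrix.det_one]
  rw [← hd, ← hk]
  simp only [zk, mY_act, mC_act, B0_act]
  have e1 : (((gY g)⁻¹).val * mC W * hD g) * Ek m k * (((gY g)⁻¹).val * mC W * hD g).adjugate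
      = (hD g).det • (((gY g)⁻¹).val * (mC W * Ek m k * (mC W).adjugate) *
        ((gY g)⁻¹).val.adjugate) := by
    rw [Matrix.adjugate_mul_distrib, Matrix.adjugate_mul_distrib]
    calc _ = ((gY g)⁻¹).val * mC W * (hD g * Ek m k * (hD g).adjugate) *
          ((mC W).adjugate * ((gY g)⁻¹).val.adjugate) := by simp only [Matrix.mul_assoc]
      _ = _ := by
        rw [hD_comm, Matrix.mul_assoc (Ek m k), Matrix.mul_adjugate]
        simp only [Matrix.mul_smul, Matrix.smul_mul, Matrix.mul_one, Matrix.mul_assoc]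
  rw [e1]
  generalize mC W * Ek m k * (mC W).adjugate = F
  calc _ = (hD g).det • (Matrix.diagonal (fun j => (gs g j)⁻¹) * mY W *
        ((gY g).val * ((gY g)⁻¹).val) * F *
        (((gY g)⁻¹).val.adjugate * ((gY g)⁻¹).val) * B0 W * Matrix.diagonal (gt g)) := by
        simp only [Matrix.mul_assoc, Matrix.mul_smul, Matrix.smul_mul]
    _ = _ := by
        rw [Units.mul_inv, Matrix.adjugate_mul]
        simp only [Matrix.mul_smul, Matrix.smul_mul, Matrix.mul_one, Matrix.mul_assoc, smul_smul]

noncomputable def Zrep (W : TRep m n p) : QRep m n p :=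
  fun x => (Matrix.of fun _ _ => zk W x.2.2 x.2.1 x.1 : Matrix (Fin 1) (Fin 1) ℂ)

lemma qz_Zrep (W : TRep m n p) (i j k) : qz (Zrep W) i j k = zk W k j i := rfl

/-- stacked identity -/
def Sm (m p : ℕ) : Matrix (PI m p) (Fin m) ℂ := Matrix.of fun ck i => if ck.1 = i then 1 else 0

def yz (z : QRep m n p) : Matrix (Fin n) (PI m p) ℂ := Matrix.of fun j ck => qz z ck.1 j ck.2

noncomputable def W0 (z : QRep m n p) : TRep m n p := ofMod 1 (Matrix.fromCols (Sm m p) 1) (yz z)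

lemma B0_W0 (z : QRep m n p) : B0 (W0 z) = Sm m p := by
  simp [B0, W0, mX_ofMod, mA_ofMod]

lemma mC_W0 (z : QRep m n p) : mC (W0 z) = 1 := by
  simp [mC, W0, mX_ofMod, mA_ofMod]

lemma Zrep_W0 (z : QRep m n p) : Zrep (W0 z) = z := by
  apply q_ext
  intro i j k
  rw [qz_Zrep, zk, mC_W0, B0_W0, W0, mY_ofMod]
  simp only [Matrix.one_mul, Matrix.adjugate_one, Matrix.mul_one, Matrix.mul_assoc]
  have : Ek m k * Sm m p = Matrix.of fun ck i => if ck.1 = i ∧ ck.2 = k then 1 else 0 := by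
    ext ⟨c, l⟩ i
    rw [Matrix.mul_apply, Fintype.sum_prod_type]
    by_cases h : l = k
    · subst h
      simp [Ek, Sm, Matrix.blockDiagonal_apply, Matrix.one_apply, ite_and]
    · simp [Ek, Sm, Matrix.blockDiagonal_apply, Matrix.one_apply, h]
  rw [this, Matrix.mul_apply, Fintype.sum_prod_type]
  simp [yz, ite_and]

lemma gt_ne (g : TGL m n p) (i : Fin m) : gt g i ≠ 0 := by
  have h : (reU (ex n i) (gAt g (.x (Fin.castAdd p i)))).val.det = gt g i := by
    simp only [reU_val, Matrix.det_unique]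
    rfl
  rw [← h]
  exact ((Matrix.isUnit_iff_isUnit_det _).mp (Units.isUnit _)).ne_zero

lemma udet_ne {ι : Type*} [Fintype ι] [DecidableEq ι] (u : (Matrix ι ι ℂ)ˣ) : u.val.det ≠ 0 :=
  ((Matrix.isUnit_iff_isUnit_det _).mp (Units.isUnit _)).ne_zero

lemma gs_ne (g : TGL m n p) (j : Fin n) : gs g j ≠ 0 := by
  have h := udet_ne (gS g j)
  rwa [Matrix.det_fin_one] at h

lemma u1_ne (u : (Matrix (Fin 1) (Fin 1) ℂ)ˣ) : u.val 0 0 ≠ 0 := by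
  have h := udet_ne u
  rwa [Matrix.det_fin_one] at h

lemma exists_gq (t : Fin m → ℂˣ) (s : Fin n → ℂˣ) :
    ∃ g : QGL m n p, (∀ i, (gq g (Sum.inl i)).val 0 0 = t i) ∧
      ∀ j, (gq g (Sum.inr j)).val 0 0 = s j := by
  let g : Fin m ⊕ Fin n → (Matrix (Fin 1) (Fin 1) ℂ)ˣ :=
    Sum.elim (fun i => u1 (t i)) (fun j => u1 (s j))
  exact ⟨g, fun i => u1_apply (t i), fun j => u1_apply (s j)⟩

lemma detWeight_T_ne (g : TGL m n p) (a : Fin m → ℕ) (b : Fin n → ℕ) (N : ℕ) :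
    (Tquiv m p n).detWeight (sigmaHat m p n a b N) g ≠ 0 := by
  unfold FinQuiver.detWeight
  exact Finset.prod_ne_zero_iff.mpr fun v _ => zpow_ne_zero _ (udet_ne _)

/-! polynomiality of coordinates -/

lemma pf_mX (q c : KI m p) : (Tquiv m p n).IsPolyFun (fun W : TRep m n p => mX W q c) := by
  rcases c with i | ⟨c, k⟩
  · exact pf_coord (Q := Tquiv m p n) (β := betaHat m p n) (Sum.inl (Fin.castAdd p i)) _ _
  · exact pf_coord (Q := Tquiv m p n) (β := betaHat m p n) (Sum.inl (Fin.natAdd m k)) _ _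

lemma pf_mA (q c) : (Tquiv m p n).IsPolyFun (fun W : TRep m n p => mA W q c) :=
  pf_coord (Q := Tquiv m p n) (β := betaHat m p n) (Sum.inr (Sum.inl ())) _ _

lemma pf_mY (q c) : (Tquiv m p n).IsPolyFun (fun W : TRep m n p => mY W q c) :=
  pf_coord (Q := Tquiv m p n) (β := betaHat m p n) (Sum.inr (Sum.inr q)) _ _

lemma pf_B0 (q c) : (Tquiv m p n).IsPolyFun (fun W : TRep m n p => B0 W q c) :=
  pf_matmul pf_mA pf_mX q (Sum.inl c)

lemma pf_mC (q c) : (Tquiv m p n).IsPolyFun (fun W : TRep m n p => mC W q c) :=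
  pf_matmul pf_mA pf_mX q (Sum.inr c)

lemma pf_zk (k : Fin p) (j i) : (Tquiv m p n).IsPolyFun (fun W : TRep m n p => zk W k j i) := by
  unfold zk
  refine pf_matmul (pf_matmul pf_mY (pf_matmul (pf_matmul pf_mC ?_) (pf_adj pf_mC))) pf_B0 j i
  exact fun _ _ => pf_const _

lemma Phi_mem (a : Fin m → ℕ) (b : Fin n → ℕ) (N : ℕ) (hNa : N = ∑ i : Fin m, a i)
    {H : QRep m n p → ℂ} (hH : H ∈ (Qpmn m n p).SIw (fun _ => 1) (thetaAB a b)) :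
    (fun W => H (Zrep W)) ∈ (Tquiv m p n).SIw (betaHat m p n) (sigmaHat m p n a b N) := by
  refine ⟨pf_comp hH.1 fun x _ _ => pf_zk x.2.2 x.2.1 x.1, fun g W => ?_⟩
  have hd : (∏ k, (gh g k).val.det) * ((gY g).val.det)⁻¹ ≠ 0 :=
    mul_ne_zero (Finset.prod_ne_zero_iff.mpr fun k _ => udet_ne _) (inv_ne_zero (udet_ne _))
  set d := (∏ k, (gh g k).val.det) * ((gY g).val.det)⁻¹ with hdd
  obtain ⟨g', h1, h2⟩ := exists_gq (m := m) (n := n) (p := p)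
    (fun i => Units.mk0 (gt g i * d) (mul_ne_zero (gt_ne g i) hd))
    (fun j => Units.mk0 (gs g j) (gs_ne g j))
  have key : Zrep ((Tquiv m p n).invAct g W) = (Qpmn m n p).invAct g' (Zrep W) := by
    apply q_ext
    intro i j k
    rw [qz_act, qz_Zrep, qz_Zrep, zk_act, ← hdd, h1, h2]
    simp only [Matrix.smul_apply, Matrix.mul_diagonal, Matrix.diagonal_mul, Units.val_mk0,
      smul_eq_mul]
    ring
  show H (Zrep ((Tquiv m p n).invAct g W)) = _ * H (Zrep W)
  rw [key, hH.2 g' (Zrep W), detWeight_Q, detWeight_T]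
  congr 1
  simp only [h1, h2, Units.val_mk0, mul_pow, Finset.prod_mul_distrib,
    Finset.prod_pow_eq_pow_sum, ← hNa]
  rw [hdd, mul_pow, inv_pow]
  ring

lemma pf_W0 (x r c) : (Qpmn m n p).IsPolyFun (fun z : QRep m n p => W0 z x r c) := by
  rcases x with l | u | j
  · exact pf_const ((W0 (fun _ => 0) : TRep m n p) (Sum.inl l) r c)
  · exact pf_const ((W0 (fun _ => 0) : TRep m n p) (Sum.inr (Sum.inl u)) r c)
  · exact pf_coord (Q := Qpmn m n p) (β := fun _ => 1)
      ((eY m p n c).1, j, (eY m p n c).2) 0 0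

lemma Psi_mem (a : Fin m → ℕ) (b : Fin n → ℕ) (N : ℕ)
    {f : TRep m n p → ℂ}
    (hf : f ∈ (Tquiv m p n).SIw (betaHat m p n) (sigmaHat m p n a b N)) :
    (fun z => f (W0 z)) ∈ (Qpmn m n p).SIw (fun _ => 1) (thetaAB a b) := by
  refine ⟨pf_comp hf.1 pf_W0, fun g z => ?_⟩
  let t : Fin m → ℂˣ := fun i => Units.mk0 ((gq g (Sum.inl i)).val 0 0) (u1_ne _)
  let s : Fin n → ℂˣ := fun i => Units.mk0 ((gq g (Sum.inr i)).val 0 0) (u1_ne _)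
  let tv : Fin m → ℂ := fun i => t i
  have hdet : (Matrix.diagonal tv).det ≠ 0 := by
    rw [Matrix.det_diagonal]
    exact Finset.prod_ne_zero_iff.mpr fun i _ => (t i).ne_zero
  let h : (Matrix (Fin m) (Fin m) ℂ)ˣ := Matrix.nonsingInvUnit _ hdet.isUnit
  let Hm : Matrix (PI m p) (PI m p) ℂ := Matrix.blockDiagonal fun _ => Matrix.diagonal tv
  have hHm : Hm.det = ∏ _k : Fin p, (Matrix.diagonal tv).det := Matrix.det_blockDiagonal _
  have hHdet : Hm.det ≠ 0 := by
    rw [hHm]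
    exact Finset.prod_ne_zero_iff.mpr fun i _ => hdet
  let D : Matrix (KI m p) (KI m p) ℂ := Matrix.fromBlocks (Matrix.diagonal tv) 0 0 Hm
  have hDdet : D.det ≠ 0 := by
    rw [Matrix.det_fromBlocks_zero₂₁]
    exact mul_ne_zero hdet hHdet
  obtain ⟨g', h1, h2, h3, h4, h5⟩ := exists_g (n := n) t (fun _ => h)
    (Matrix.nonsingInvUnit D hDdet.isUnit) (Matrix.nonsingInvUnit Hm hHdet.isUnit) s
  have v2 : ∀ k, (gh g' k).val = Matrix.diagonal tv := fun k => by rw [h2]; rfl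
  have v3 : (gX g').val = D := by rw [h3]; rfl
  have v4 : (gY g').val = Hm := by rw [h4]; rfl
  have v1 : gt g' = tv := funext h1
  have vD : gD g' = D := by
    simp only [gD, v1, v2, D, Hm]
  have key : (Tquiv m p n).invAct g' (W0 z) = W0 ((Qpmn m n p).invAct g z) := by
    apply mod_ext
    · rw [mX_act, W0, mX_ofMod, vD, W0, mX_ofMod, Matrix.mul_one, ← v3, Units.inv_mul]
    · rw [mA_act, W0, mA_ofMod, v3, W0, mA_ofMod, Matrix.mul_assoc,
        Matrix.fromCols_mul_fromBlocks]
      have hS : Sm m p * Matrix.diagonal tv = Hm * Sm m p := by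
        ext ⟨c, k⟩ i
        simp only [Matrix.mul_diagonal]
        rw [Matrix.mul_apply, Fintype.sum_prod_type]
        simp [Hm, Sm, Matrix.blockDiagonal_apply, Matrix.diagonal_apply, ite_and]
        split_ifs with hci
        · rw [hci]
        · rfl
      simp only [Matrix.mul_zero, add_zero, zero_add, Matrix.one_mul]
      rw [hS, Matrix.mul_fromCols, ← v4, ← Matrix.mul_assoc, Units.inv_mul, Matrix.one_mul]
    · rw [mY_act, W0, mY_ofMod, v4, W0, mY_ofMod]
      ext j ⟨c, k⟩
      rw [Matrix.mul_apply, Fintype.sum_prod_type]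
      simp only [Matrix.diagonal_mul, yz, Matrix.of_apply, qz_act, h5]
      simp [Hm, Matrix.blockDiagonal_apply, Matrix.diagonal_apply, s, tv, t, ite_and]
  show f (W0 ((Qpmn m n p).invAct g z)) = _ * f (W0 z)
  rw [← key, hf.2 g' (W0 z), detWeight_Q, detWeight_T]
  congr 1
  simp only [v2, v4, hHm, h1, h5]
  rw [mul_assoc (∏ i, _), mul_inv_cancel₀, mul_one]
  · rfl
  · rw [← hHm]
    exact pow_ne_zero _ hHdet

noncomputable def adjB (W : TRep m n p) (k : Fin p) : Matrix (Fin m) (Fin m) ℂ :=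
  Matrix.of fun c i => ((mC W).adjugate * B0 W) (c, k) i

noncomputable def qf (W : TRep m n p) : ℂ :=
  (mX W).det * (mC W).det * ∏ k, (adjB W k).det

lemma pf_qf : (Tquiv m p n).IsPolyFun (fun W : TRep m n p => qf W) := by
  unfold qf
  refine pf_mul (pf_mul (pf_det pf_mX) (pf_det pf_mC)) (pf_prod _ fun k => pf_det fun c i => ?_)
  exact pf_matmul (pf_adj pf_mC) pf_B0 (c, k) i

lemma qf_W0 (z : QRep m n p) : qf (W0 z) = 1 := by
  have h : ∀ k, adjB (W0 z) k = 1 := by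
    intro k
    ext c i
    simp [adjB, mC_W0, B0_W0, Sm, Matrix.one_apply]
  simp only [qf, h, mC_W0]
  simp [W0, mX_ofMod]

lemma orbit (W : TRep m n p) (hq : qf W ≠ 0) :
    ∃ (g : TGL m n p) (z : QRep m n p), (Tquiv m p n).invAct g W = W0 z := by
  have hX : (mX W).det ≠ 0 := fun h => hq (by simp [qf, h])
  have hC : (mC W).det ≠ 0 := fun h => hq (by simp [qf, h])
  have hk : ∀ k, (adjB W k).det ≠ 0 := fun k h =>
    hq (by rw [qf, Finset.prod_eq_zero (Finset.mem_univ k) h, mul_zero])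
  let hm : Fin p → Matrix (Fin m) (Fin m) ℂ := fun k => (mC W).det⁻¹ • adjB W k
  have hmd : ∀ k, (hm k).det ≠ 0 := by
    intro k
    rw [Matrix.det_smul]
    exact mul_ne_zero (pow_ne_zero _ (inv_ne_zero hC)) (hk k)
  let Hm : Matrix (PI m p) (PI m p) ℂ := Matrix.blockDiagonal hm
  have hHdet : Hm.det ≠ 0 := by
    rw [Matrix.det_blockDiagonal]
    exact Finset.prod_ne_zero_iff.mpr fun i _ => hmd i
  let D : Matrix (KI m p) (KI m p) ℂ := Matrix.fromBlocks 1 0 0 Hm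
  have hDdet : D.det ≠ 0 := by
    rw [Matrix.det_fromBlocks_zero₂₁, Matrix.det_one, one_mul]
    exact hHdet
  have hγ : (mX W * D).det ≠ 0 := by
    rw [Matrix.det_mul]; exact mul_ne_zero hX hDdet
  have hκ : (mC W * Hm).det ≠ 0 := by
    rw [Matrix.det_mul]; exact mul_ne_zero hC hHdet
  obtain ⟨g, h1, h2, h3, h4, h5⟩ := exists_g (n := n) (fun _ => 1)
    (fun k => Matrix.nonsingInvUnit (hm k) (hmd k).isUnit)
    (Matrix.nonsingInvUnit _ hγ.isUnit) (Matrix.nonsingInvUnit _ hκ.isUnit) (fun _ => 1)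
  have v2 : ∀ k, (gh g k).val = hm k := fun k => by rw [h2]; rfl
  have v3 : (gX g).val = mX W * D := by rw [h3]; rfl
  have v4 : (gY g).val = mC W * Hm := by rw [h4]; rfl
  have v1 : gt g = fun _ => 1 := by
    funext i
    simp [h1]
  have vD : gD g = D := by
    simp only [gD, v1, v2, D, Hm, Matrix.diagonal_one]
  let z : QRep m n p := fun x => (Matrix.of fun _ _ => (mY W * (gY g).val) x.2.1 (x.1, x.2.2) :
    Matrix (Fin 1) (Fin 1) ℂ)
  refine ⟨g, z, ?_⟩
  apply mod_ext
  · rw [mX_act, vD, W0, mX_ofMod, Matrix.mul_assoc, ← v3, Units.inv_mul]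
  · rw [mA_act, W0, mA_ofMod, v3, Matrix.mul_assoc, ← Matrix.mul_assoc (mA W), B_eq,
      Matrix.fromCols_mul_fromBlocks]
    have hS : B0 W = (mC W * Hm) * Sm m p := by
      have e : Hm * Sm m p = (mC W).det⁻¹ • ((mC W).adjugate * B0 W) := by
        ext ⟨c, k⟩ i
        rw [Matrix.mul_apply, Fintype.sum_prod_type]
        simp [Hm, Sm, Matrix.blockDiagonal_apply, hm, adjB]
      rw [Matrix.mul_assoc, e, Matrix.mul_smul, ← Matrix.mul_assoc, Matrix.mul_adjugate,
        Matrix.smul_mul, smul_smul, inv_mul_cancel₀ hC, one_smul, Matrix.one_mul]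
    simp only [Matrix.mul_zero, add_zero, zero_add, Matrix.mul_one]
    rw [Matrix.mul_fromCols, ← v4, Units.inv_mul]
    congr 1
    conv_lhs => rw [hS, ← v4]
    rw [← Matrix.mul_assoc, Units.inv_mul, Matrix.one_mul]
  · rw [mY_act, W0, mY_ofMod]
    ext j ⟨c, k⟩
    simp only [h5, Units.val_one, inv_one, Matrix.diagonal_one, Matrix.one_mul]
    rfl

noncomputable def Psi (a : Fin m → ℕ) (b : Fin n → ℕ) (N : ℕ) :
    (Tquiv m p n).SIw (betaHat m p n) (sigmaHat m p n a b N) →ₗ[ℂ]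
      (Qpmn m n p).SIw (fun _ => 1) (thetaAB a b) where
  toFun f := ⟨fun z => f.1 (W0 z), Psi_mem a b N f.2⟩
  map_add' _ _ := rfl
  map_smul' _ _ := rfl

lemma Psi_bij (a : Fin m → ℕ) (b : Fin n → ℕ) (N : ℕ) (hNa : N = ∑ i : Fin m, a i) :
    Function.Bijective (Psi (m := m) (n := n) (p := p) a b N) := by
  constructor
  · rw [injective_iff_map_eq_zero]
    intro f hf
    have hz : ∀ z : QRep m n p, f.1 (W0 z) = 0 := fun z =>
      congrFun (congrArg Subtype.val hf) z
    let z0 : QRep m n p := fun _ => 0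
    apply Subtype.ext
    refine pf_dense f.2.1 pf_qf (W0 z0) (by rw [qf_W0]; exact one_ne_zero) ?_
    intro W hW
    obtain ⟨g, z, hg⟩ := orbit W hW
    have h1 := f.2.2 g W
    rw [hg, hz] at h1
    exact (mul_eq_zero.mp h1.symm).resolve_left (detWeight_T_ne g a b N)
  · intro H
    refine ⟨⟨fun W => H.1 (Zrep W), Phi_mem a b N hNa H.2⟩, ?_⟩
    apply Subtype.ext
    funext z
    show H.1 (Zrep (W0 z)) = H.1 z
    rw [Zrep_W0]

end Model

end TProof

/-- `dim SI(Q^p_{m,n}, 𝟏)_{θ_{a,b}} = dim SI(𝒯, β̂)_{σ̂_{a,b}}`. -/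
theorem siDim_Qpmn_eq_siDim_T
    (m n p : ℕ) (hm : 0 < m) (hn : 0 < n) (hp : 0 < p)
    (a : Fin m → ℕ) (b : Fin n → ℕ) (N : ℕ)
    (hNa : N = ∑ i : Fin m, a i) (hNb : N = ∑ j : Fin n, b j) :
    (Qpmn m n p).siDim (fun _ => 1) (thetaAB a b) =
      (Tquiv m p n).siDim (betaHat m p n) (sigmaHat m p n a b N) := by
  exact (LinearEquiv.finrank_eq
    (LinearEquiv.ofBijective _ (TProof.Psi_bij a b N hNa))).symm
end

section
/- With margin vectors a ∈ ℕ^m, b ∈ ℕ^n satisfying N = Σ a_i = Σ b_j, one has dim_ℂ SI(𝒯, β̂)_{σ̂_{a,b}} = dim_ℂ SI(𝒮, β)_{σ_{a,b}}, where 𝒯, β̂, σ̂_{a,b} are the three-level star quiver data and 𝒮, β, σ_{a,b} are the star quiver data obtained from 𝒯 by deleting the vertex x₀ (which has weight 0 and dimension (p+1)m ≥ pm) and composing arrows through it. -/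
/-- The vertices of the star quiver `𝒮`: sources `x₁,…,x_{m+p}`, center `z₀`,
sinks `y₁,…,y_n`. -/
inductive SVert (m p n : ℕ) : Type where
  | x : Fin (m + p) → SVert m p n
  | z0 : SVert m p n
  | y : Fin n → SVert m p n
  deriving DecidableEq, Fintype

/-- The star quiver `𝒮` with arrows `x_ℓ → z₀` (`ℓ ∈ [m+p]`) and `z₀ → y_j` (`j ∈ [n]`). -/
def Squiv (m p n : ℕ) : FinQuiver where
  V := SVert m p n
  A := Fin (m + p) ⊕ Fin n
  t := Sum.elim (fun ℓ => SVert.x ℓ) (fun _ => SVert.z0)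
  h := Sum.elim (fun _ => SVert.z0) (fun j => SVert.y j)

/-- The dimension vector `β` of `𝒮`: value `1` at `x₁,…,x_m`, `m` at `x_{m+1},…,x_{m+p}`,
`mp` at `z₀`, `1` at the `y_j`. -/
def betaS (m p n : ℕ) : SVert m p n → ℕ
  | .x ℓ => if ℓ.val < m then 1 else m
  | .z0 => m * p
  | .y _ => 1

/-- The weight `σ_{a,b}` of `𝒮`: `a_ℓ` at `x_ℓ` (`ℓ ∈ [m]`), `N` at `x_{m+1},…,x_{m+p}`,
`−N` at `z₀`, `−b_j` at `y_j`. -/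
def sigmaS (m p n : ℕ) (a : Fin m → ℕ) (b : Fin n → ℕ) (N : ℕ) : SVert m p n → ℤ
  | .x ℓ => if h : ℓ.val < m then (a ⟨ℓ.val, h⟩ : ℤ) else (N : ℤ)
  | .z0 => -(N : ℤ)
  | .y j => -(b j : ℤ)


namespace FinQuiver

/-- Polynomial functions form a subalgebra. -/
noncomputable def polySub (Q : FinQuiver) (β : Q.V → ℕ) : Subalgebra ℂ (Q.Rep β → ℂ) where
  carrier := {f | Q.IsPolyFun f}
  mul_mem' := by
    rintro f g ⟨P, hP⟩ ⟨R, hR⟩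
    exact ⟨P * R, fun W => by simp [hP W, hR W]⟩
  add_mem' := by
    rintro f g ⟨P, hP⟩ ⟨R, hR⟩
    exact ⟨P + R, fun W => by simp [hP W, hR W]⟩
  algebraMap_mem' := by
    intro c
    exact ⟨MvPolynomial.C c, fun W => by simp⟩

theorem mem_polySub {Q : FinQuiver} {β : Q.V → ℕ} {f : Q.Rep β → ℂ} :
    f ∈ Q.polySub β ↔ Q.IsPolyFun f := Iff.rfl

theorem coord_mem {Q : FinQuiver} {β : Q.V → ℕ} (a : Q.A) (i : Fin (β (Q.h a)))
    (j : Fin (β (Q.t a))) : (fun W : Q.Rep β => W a i j) ∈ Q.polySub β :=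
  ⟨MvPolynomial.X ⟨a, i, j⟩, fun W => by simp⟩

theorem const_mem {Q : FinQuiver} {β : Q.V → ℕ} (c : ℂ) :
    (fun _ : Q.Rep β => c) ∈ Q.polySub β :=
  ⟨MvPolynomial.C c, fun W => by simp⟩

theorem IsPolyFun.comp {Q R : FinQuiver} {β : Q.V → ℕ} {γ : R.V → ℕ} {f : R.Rep γ → ℂ}
    (hf : R.IsPolyFun f) (Φ : Q.Rep β → R.Rep γ)
    (hΦ : ∀ a i j, Q.IsPolyFun (fun W => Φ W a i j)) : Q.IsPolyFun (fun W => f (Φ W)) := by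
  obtain ⟨P, hP⟩ := hf
  choose c hc using hΦ
  refine ⟨MvPolynomial.bind₁ (fun k => c k.1 k.2.1 k.2.2) P, fun W => ?_⟩
  refine (hP (Φ W)).trans ?_
  rw [MvPolynomial.eval, MvPolynomial.eval, MvPolynomial.eval₂Hom_bind₁]
  congr 2
  funext k
  exact hc _ _ _ W

theorem IsPolyFun.density {Q : FinQuiver} {β : Q.V → ℕ} {f₁ f₂ d : Q.Rep β → ℂ}
    (h₁ : Q.IsPolyFun f₁) (h₂ : Q.IsPolyFun f₂) (hd : Q.IsPolyFun d)
    (hne : ∃ W, d W ≠ 0) (h : ∀ W, d W ≠ 0 → f₁ W = f₂ W) : f₁ = f₂ := by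
  obtain ⟨P₁, h₁⟩ := h₁
  obtain ⟨P₂, h₂⟩ := h₂
  obtain ⟨D, hd⟩ := hd
  have key : (P₁ - P₂) * D = 0 := by
    apply MvPolynomial.funext
    intro s
    have e₁ := h₁ (fun a i j => s ⟨a, i, j⟩)
    have e₂ := h₂ (fun a i j => s ⟨a, i, j⟩)
    have e₃ := hd (fun a i j => s ⟨a, i, j⟩)
    have e := h (fun a i j => s ⟨a, i, j⟩)
    simp only [map_mul, map_sub, map_zero]
    change _ = MvPolynomial.eval s P₁ at e₁
    change _ = MvPolynomial.eval s P₂ at e₂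
    change _ = MvPolynomial.eval s D at e₃
    rw [e₁, e₂, e₃] at e
    by_cases h0 : MvPolynomial.eval s D = 0
    · simp [h0]
    · simp [e h0]
  rcases mul_eq_zero.1 key with h0 | h0
  · funext W
    rw [h₁, h₂, sub_eq_zero.1 h0]
  · obtain ⟨W, hW⟩ := hne
    exact absurd (by rw [hd, h0]; simp) hW

end FinQuiver

namespace TS

open FinQuiver Matrix

/-- dimension at the source vertices -/
abbrev dx (m p : ℕ) (ℓ : Fin (m + p)) : ℕ := if ℓ.val < m then 1 else m

theorem sum_dx (m p : ℕ) : ∑ ℓ, dx m p ℓ = (p + 1) * m := by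
  rw [Fin.sum_univ_add]
  simp [dx]
  ring

noncomputable def e (m p : ℕ) : (Σ ℓ : Fin (m + p), Fin (dx m p ℓ)) ≃ Fin ((p + 1) * m) :=
  Fintype.equivFinOfCardEq (by simp only [Fintype.card_sigma, Fintype.card_fin]; exact sum_dx m p)

def c (m p : ℕ) : Fin (p * m) ≃ Fin (m * p) := finCongr (mul_comm _ _)

abbrev TRep (m p n : ℕ) := (Tquiv m p n).Rep (betaHat m p n)
abbrev SRep (m p n : ℕ) := (Squiv m p n).Rep (betaS m p n)

variable {m p n : ℕ}

def tX (W : TRep m p n) (ℓ : Fin (m + p)) : Matrix (Fin ((p + 1) * m)) (Fin (dx m p ℓ)) ℂ :=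
  W (Sum.inl ℓ)
def tB (W : TRep m p n) : Matrix (Fin (p * m)) (Fin ((p + 1) * m)) ℂ :=
  W (Sum.inr (Sum.inl ()))
def tY (W : TRep m p n) (j : Fin n) : Matrix (Fin 1) (Fin (p * m)) ℂ :=
  W (Sum.inr (Sum.inr j))
def sX (W : SRep m p n) (ℓ : Fin (m + p)) : Matrix (Fin (m * p)) (Fin (dx m p ℓ)) ℂ :=
  W (Sum.inl ℓ)
def sY (W : SRep m p n) (j : Fin n) : Matrix (Fin 1) (Fin (m * p)) ℂ :=
  W (Sum.inr j)

def mkT (X : ∀ ℓ : Fin (m + p), Matrix (Fin ((p + 1) * m)) (Fin (dx m p ℓ)) ℂ)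
    (B : Matrix (Fin (p * m)) (Fin ((p + 1) * m)) ℂ)
    (Y : Fin n → Matrix (Fin 1) (Fin (p * m)) ℂ) : TRep m p n
  | Sum.inl ℓ => X ℓ
  | Sum.inr (Sum.inl _) => B
  | Sum.inr (Sum.inr j) => Y j

def mkS (X : ∀ ℓ : Fin (m + p), Matrix (Fin (m * p)) (Fin (dx m p ℓ)) ℂ)
    (Y : Fin n → Matrix (Fin 1) (Fin (m * p)) ℂ) : SRep m p n
  | Sum.inl ℓ => X ℓ
  | Sum.inr j => Y j

theorem T_ext {W W' : TRep m p n} (h₁ : ∀ ℓ, tX W ℓ = tX W' ℓ) (h₂ : tB W = tB W')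
    (h₃ : ∀ j, tY W j = tY W' j) : W = W' := by
  funext k
  rcases k with ℓ | u | j
  · exact h₁ ℓ
  · exact h₂
  · exact h₃ j

theorem S_ext {W W' : SRep m p n} (h₁ : ∀ ℓ, sX W ℓ = sX W' ℓ)
    (h₃ : ∀ j, sY W j = sY W' j) : W = W' := by
  funext k
  rcases k with ℓ | j
  · exact h₁ ℓ
  · exact h₃ j

/-- all the `x`-matrices put in one square matrix -/
noncomputable def bigA (W : TRep m p n) : Matrix (Fin ((p + 1) * m)) (Fin ((p + 1) * m)) ℂ :=
  fun i j => tX W ((e m p).symm j).1 i ((e m p).symm j).2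

noncomputable def Phi (W : TRep m p n) : SRep m p n :=
  mkS (fun ℓ => (tB W * tX W ℓ).submatrix (c m p).symm id)
    (fun j => (tY W j).submatrix id (c m p).symm)

noncomputable def unitX (ℓ : Fin (m + p)) : Matrix (Fin ((p + 1) * m)) (Fin (dx m p ℓ)) ℂ :=
  fun i k => (1 : Matrix (Fin ((p + 1) * m)) (Fin ((p + 1) * m)) ℂ) i (e m p ⟨ℓ, k⟩)

noncomputable def Psi (X : SRep m p n) : TRep m p n :=
  mkT unitX (fun r i => sX X ((e m p).symm i).1 (c m p r) ((e m p).symm i).2)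
    (fun j => (sY X j).submatrix id (c m p))

theorem mul_unitX {r : Type} (B : Matrix r (Fin ((p + 1) * m)) ℂ) (ℓ : Fin (m + p)) :
    B * unitX ℓ = fun i k => B i (e m p ⟨ℓ, k⟩) := by
  have : unitX ℓ = (1 : Matrix (Fin ((p + 1) * m)) (Fin ((p + 1) * m)) ℂ).submatrix id
    (fun k => e m p ⟨ℓ, k⟩) := rfl
  rw [this]
  ext i k
  simp [Matrix.mul_apply, Matrix.one_apply]

theorem Phi_Psi (X : SRep m p n) : Phi (Psi X) = X := by
  apply S_ext
  · intro ℓ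
    change ((tB (Psi X)) * unitX ℓ).submatrix (c m p).symm id = _
    rw [mul_unitX]
    ext i k
    change sX X ((e m p).symm (e m p ⟨ℓ, k⟩)).1 (c m p ((c m p).symm i))
      ((e m p).symm (e m p ⟨ℓ, k⟩)).2 = _
    rw [Equiv.symm_apply_apply, Equiv.apply_symm_apply]
  · intro j
    change ((sY X j).submatrix id (c m p)).submatrix id (c m p).symm = _
    ext i k
    simp

theorem Phi_poly (a i j) : IsPolyFun _ (fun W : TRep m p n => Phi W a i j) := by
  rcases a with ℓ | y
  · change (fun W : TRep m p n => ∑ k, tB W ((c m p).symm i) k * tX W ℓ k j) ∈ polySub _ _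
    have : (fun W : TRep m p n => ∑ k, tB W ((c m p).symm i) k * tX W ℓ k j) =
      ∑ k, (fun W : TRep m p n => tB W ((c m p).symm i) k) * (fun W => tX W ℓ k j) := by
      funext W; simp
    rw [this]
    exact sum_mem fun k _ => mul_mem (coord_mem (Q := Tquiv m p n) _ _ _)
      (coord_mem (Q := Tquiv m p n) _ _ _)
  · exact coord_mem (Q := Tquiv m p n) (β := betaHat m p n) (Sum.inr (Sum.inr y)) _ _

theorem Psi_poly (a i j) : IsPolyFun _ (fun W : SRep m p n => Psi W a i j) := by
  rcases a with ℓ | u | y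
  · exact const_mem (Q := Squiv m p n) _
  · exact coord_mem (Q := Squiv m p n) (β := betaS m p n) (Sum.inl _) _ _
  · exact coord_mem (Q := Squiv m p n) (β := betaS m p n) (Sum.inr y) _ _

theorem det_poly : IsPolyFun _ (fun W : TRep m p n => (bigA W).det) := by
  have : (fun W : TRep m p n => (bigA W).det) = ∑ s : Equiv.Perm (Fin ((p + 1) * m)),
      (fun _ : TRep m p n => ((Equiv.Perm.sign s : ℤ) : ℂ)) *
        ∏ i, (fun W : TRep m p n => bigA W (s i) i) := by
    funext W
    simp [Matrix.det_apply']
  rw [this]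
  exact sum_mem fun s _ => mul_mem (const_mem (Q := Tquiv m p n) _)
    (prod_mem fun k _ => coord_mem (Q := Tquiv m p n) (β := betaHat m p n) (Sum.inl _) _ _)

theorem bigA_Psi (X : SRep m p n) : bigA (Psi X) = 1 := by
  ext i j
  change (1 : Matrix (Fin ((p + 1) * m)) (Fin ((p + 1) * m)) ℂ) i
    (e m p ⟨((e m p).symm j).1, ((e m p).symm j).2⟩) = _
  rw [Sigma.eta, Equiv.apply_symm_apply]

theorem bigA_unitX (W : TRep m p n) (ℓ : Fin (m + p)) : bigA W * unitX ℓ = tX W ℓ := by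
  rw [mul_unitX]
  ext i k
  change tX W ((e m p).symm (e m p ⟨ℓ, k⟩)).1 i ((e m p).symm (e m p ⟨ℓ, k⟩)).2 = _
  rw [Equiv.symm_apply_apply]

def vEquiv (m p n : ℕ) : Option (SVert m p n) ≃ TVert m p n where
  toFun
    | none => .x0
    | some (.x ℓ) => .x ℓ
    | some .z0 => .y0
    | some (.y j) => .y j
  invFun
    | .x0 => none
    | .x ℓ => some (.x ℓ)
    | .y0 => some .z0
    | .y j => some (.y j)
  left_inv := by rintro (_ | _ | _ | _) <;> rfl
  right_inv := by rintro (_ | _ | _ | _) <;> rfl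

theorem prod_T (f : TVert m p n → ℂ) :
    ∏ v, f v = f .x0 * ∏ s, f (vEquiv m p n (some s)) := by
  rw [← Equiv.prod_comp (vEquiv m p n), Fintype.prod_option]
  rfl

abbrev TG (m p n : ℕ) := (Tquiv m p n).GLb (betaHat m p n)
abbrev SG (m p n : ℕ) := (Squiv m p n).GLb (betaS m p n)

abbrev MU (k : ℕ) := (Matrix (Fin k) (Fin k) ℂ)ˣ

def mkTG (X : ∀ ℓ : Fin (m + p), MU (dx m p ℓ)) (G : MU ((p + 1) * m)) (H : MU (p * m))
    (Y : Fin n → MU 1) : TG m p n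
  | .x ℓ => X ℓ
  | .x0 => G
  | .y0 => H
  | .y j => Y j

def mkSG (X : ∀ ℓ : Fin (m + p), MU (dx m p ℓ)) (H : MU (m * p))
    (Y : Fin n → MU 1) : SG m p n
  | .x ℓ => X ℓ
  | .z0 => H
  | .y j => Y j

noncomputable def re (m p : ℕ) : MU (p * m) ≃* MU (m * p) :=
  Units.mapEquiv (Matrix.reindexAlgEquiv ℂ ℂ (c m p)).toMulEquiv

theorem re_val (H : MU (p * m)) : (re m p H).val = H.val.submatrix (c m p).symm (c m p).symm := rfl

theorem re_inv_val (H : MU (p * m)) :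
    ((re m p H)⁻¹).val = (H⁻¹).val.submatrix (c m p).symm (c m p).symm := rfl

theorem det_re (H : MU (p * m)) : (re m p H).val.det = H.val.det := by
  rw [re_val, Matrix.det_submatrix_equiv_self]

theorem exTG (g : TG m p n) : ∃ X G H Y, g = mkTG X G H Y := by
  refine ⟨fun ℓ => g (.x ℓ), g .x0, g .y0, fun j => g (.y j), ?_⟩
  funext v
  cases v <;> rfl

theorem exSG (g : SG m p n) : ∃ X H Y, g = mkSG X H Y := by
  refine ⟨fun ℓ => g (.x ℓ), g .z0, fun j => g (.y j), ?_⟩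
  funext v
  cases v <;> rfl

theorem detWeight_eq (a : Fin m → ℕ) (b : Fin n → ℕ) (N : ℕ)
    (X : ∀ ℓ : Fin (m + p), MU (dx m p ℓ)) (G : MU ((p + 1) * m)) (H : MU (p * m))
    (Y : Fin n → MU 1) :
    (Tquiv m p n).detWeight (sigmaHat m p n a b N) (mkTG X G H Y) =
    (Squiv m p n).detWeight (sigmaS m p n a b N) (mkSG X (re m p H) Y) := by
  unfold detWeight
  refine (prod_T _).trans ?_
  have h0 : (mkTG X G H Y .x0).val.det ^ (sigmaHat m p n a b N .x0) = 1 := zpow_zero _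
  refine (congrArg₂ (· * ·) h0 rfl).trans ?_
  rw [one_mul]
  refine Finset.prod_congr rfl fun s _ => ?_
  rcases s with ℓ | _ | j
  · rfl
  · change H.val.det ^ (-(N : ℤ)) = (re m p H).val.det ^ (-(N : ℤ))
    rw [det_re]
  · rfl

theorem Phi_act (X : ∀ ℓ : Fin (m + p), MU (dx m p ℓ)) (G : MU ((p + 1) * m)) (H : MU (p * m))
    (Y : Fin n → MU 1) (W : TRep m p n) :
    Phi ((Tquiv m p n).invAct (mkTG X G H Y) W) =
      (Squiv m p n).invAct (mkSG X (re m p H) Y) (Phi W) := by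
  apply S_ext
  · intro ℓ
    change (((H⁻¹).val * tB W * G.val) * ((G⁻¹).val * tX W ℓ * (X ℓ).val)).submatrix
      (c m p).symm id = ((re m p H)⁻¹).val * (tB W * tX W ℓ).submatrix (c m p).symm id * (X ℓ).val
    have : ((H⁻¹).val * tB W * G.val) * ((G⁻¹).val * tX W ℓ * (X ℓ).val) =
        (H⁻¹).val * (tB W * tX W ℓ) * (X ℓ).val := by
      have hG : G.val * (G⁻¹).val = 1 := G.mul_inv
      calc _ = (H⁻¹).val * tB W * (G.val * (G⁻¹).val) * tX W ℓ * (X ℓ).val := by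
            simp only [Matrix.mul_assoc]
        _ = _ := by rw [hG]; simp only [Matrix.mul_assoc, Matrix.one_mul]
    rw [this, re_inv_val, Matrix.submatrix_mul_equiv]
    rfl
  · intro j
    change ((Y j)⁻¹.val * tY W j * H.val).submatrix id (c m p).symm =
      (Y j)⁻¹.val * (tY W j).submatrix id (c m p).symm * (re m p H).val
    rw [re_val, Matrix.mul_assoc, Matrix.mul_assoc, Matrix.submatrix_mul_equiv]
    rfl

/-- block diagonal group element -/
noncomputable def blk (X : ∀ ℓ : Fin (m + p), MU (dx m p ℓ)) : MU ((p + 1) * m) :=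
  Units.map (((Matrix.reindexAlgEquiv ℂ ℂ (e m p)).toRingEquiv.toRingHom.comp
    (Matrix.blockDiagonal'RingHom (fun ℓ => Fin (dx m p ℓ)) ℂ)) :
      (∀ ℓ, Matrix (Fin (dx m p ℓ)) (Fin (dx m p ℓ)) ℂ) →* _) (MulEquiv.piUnits.symm X)

theorem blk_val (X : ∀ ℓ : Fin (m + p), MU (dx m p ℓ)) :
    (blk X).val = (Matrix.blockDiagonal' (fun ℓ => (X ℓ).val)).submatrix (e m p).symm (e m p).symm :=
  rfl

theorem mul_blk_apply {r : Type} (D : Matrix r (Fin ((p + 1) * m)) ℂ)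
    (X : ∀ ℓ : Fin (m + p), MU (dx m p ℓ)) (i : r) (ℓ : Fin (m + p)) (k : Fin (dx m p ℓ)) :
    (D * (blk X).val) i (e m p ⟨ℓ, k⟩) = ∑ k', D i (e m p ⟨ℓ, k'⟩) * (X ℓ).val k' k := by
  rw [Matrix.mul_apply, ← Equiv.sum_comp (e m p), Fintype.sum_sigma, Finset.sum_eq_single ℓ]
  · refine Finset.sum_congr rfl fun k' _ => ?_
    rw [blk_val]
    simp [Matrix.blockDiagonal'_apply]
  · intro ℓ' _ hne
    refine Finset.sum_eq_zero fun k' _ => ?_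
    rw [blk_val]
    simp [Matrix.blockDiagonal'_apply, hne]
  · simp

theorem blk_unitX (X : ∀ ℓ : Fin (m + p), MU (dx m p ℓ)) (ℓ) :
    (blk X).val * unitX ℓ = unitX ℓ * (X ℓ).val := by
  rw [mul_unitX]
  ext i k
  have := mul_blk_apply 1 X i ℓ k
  rw [Matrix.one_mul] at this
  exact this

theorem Psi_act (X : ∀ ℓ : Fin (m + p), MU (dx m p ℓ)) (H : MU (p * m))
    (Y : Fin n → MU 1) (W : SRep m p n) :
    Psi ((Squiv m p n).invAct (mkSG X (re m p H) Y) W) =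
      (Tquiv m p n).invAct (mkTG X (blk X) H Y) (Psi W) := by
  apply T_ext
  · intro ℓ
    change unitX ℓ = ((blk X)⁻¹).val * unitX ℓ * (X ℓ).val
    rw [Matrix.mul_assoc, ← blk_unitX, ← Matrix.mul_assoc, (blk X).inv_mul, Matrix.one_mul]
  · ext r i
    obtain ⟨⟨ℓ, k⟩, rfl⟩ := (e m p).surjective i
    change (((re m p H)⁻¹).val * sX W ((e m p).symm (e m p ⟨ℓ, k⟩)).1 *
        (X ((e m p).symm (e m p ⟨ℓ, k⟩)).1).val) (c m p r) ((e m p).symm (e m p ⟨ℓ, k⟩)).2 =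
      ((H⁻¹).val * tB (Psi W) * (blk X).val) r (e m p ⟨ℓ, k⟩)
    rw [mul_blk_apply, Equiv.symm_apply_apply, Matrix.mul_apply]
    refine Finset.sum_congr rfl fun k' _ => ?_
    congr 1
    rw [Matrix.mul_apply, Matrix.mul_apply, ← Equiv.sum_comp (c m p)]
    refine Finset.sum_congr rfl fun q _ => ?_
    rw [re_inv_val]
    change (H⁻¹).val ((c m p).symm (c m p r)) ((c m p).symm (c m p q)) * _ =
      (H⁻¹).val r q * sX W ((e m p).symm (e m p ⟨ℓ, k'⟩)).1 (c m p q)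
        ((e m p).symm (e m p ⟨ℓ, k'⟩)).2
    rw [Equiv.symm_apply_apply, Equiv.symm_apply_apply, Equiv.symm_apply_apply]
  · intro j
    change ((Y j)⁻¹.val * sY W j * (re m p H).val).submatrix id (c m p) =
      (Y j)⁻¹.val * (sY W j).submatrix id (c m p) * H.val
    have : H.val = (re m p H).val.submatrix (c m p) (c m p) := by
      rw [re_val]; ext; simp
    rw [this, Matrix.mul_assoc, Matrix.mul_assoc, Matrix.submatrix_mul_equiv]
    rfl

theorem Psi_Phi_act (W : TRep m p n) (hW : (bigA W).det ≠ 0) :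
    ∃ G : MU ((p + 1) * m), Psi (Phi W) =
      (Tquiv m p n).invAct (mkTG 1 G 1 1) W := by
  obtain ⟨G, hG⟩ := (Matrix.isUnit_iff_isUnit_det _).2 (isUnit_iff_ne_zero.2 hW)
  refine ⟨G, ?_⟩
  apply T_ext
  · intro ℓ
    change unitX ℓ = (G⁻¹).val * tX W ℓ * (1 : Matrix (Fin (dx m p ℓ)) (Fin (dx m p ℓ)) ℂ)
    rw [Matrix.mul_one, ← bigA_unitX, ← hG, ← Matrix.mul_assoc, G.inv_mul, Matrix.one_mul]
  · change _ = (1 : Matrix (Fin (p * m)) (Fin (p * m)) ℂ) * tB W * G.val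
    rw [Matrix.one_mul, hG]
    ext r i
    change (tB W * tX W _) ((c m p).symm (c m p r)) _ = _
    rw [Equiv.symm_apply_apply]
    rfl
  · intro j
    change ((tY W j).submatrix id (c m p).symm).submatrix id (c m p) =
      (1 : Matrix (Fin 1) (Fin 1) ℂ) * tY W j * (1 : Matrix (Fin (p * m)) (Fin (p * m)) ℂ)
    rw [Matrix.one_mul, Matrix.mul_one]
    ext; simp

theorem detWeight_one (a : Fin m → ℕ) (b : Fin n → ℕ) (N : ℕ) (G : MU ((p + 1) * m)) :
    (Tquiv m p n).detWeight (sigmaHat m p n a b N) (mkTG 1 G 1 1) = 1 := by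
  rw [detWeight_eq, map_one]
  refine Finset.prod_eq_one fun s _ => ?_
  have : (mkSG 1 1 1 : SG m p n) s = 1 := by cases s <;> rfl
  rw [this]
  simp

theorem Psi_Phi_eq (a : Fin m → ℕ) (b : Fin n → ℕ) (N : ℕ) (f : TRep m p n → ℂ)
    (hf : f ∈ (Tquiv m p n).SIw (betaHat m p n) (sigmaHat m p n a b N)) :
    (fun W => f (Psi (Phi W))) = f := by
  refine IsPolyFun.density (Q := Tquiv m p n) (d := fun W : TRep m p n => (bigA W).det)
    ((hf.1.comp Psi Psi_poly).comp Phi Phi_poly) hf.1 det_poly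
    ⟨Psi (mkS 0 0), by rw [bigA_Psi]; simp⟩ ?_
  intro W hW
  obtain ⟨G, hG⟩ := Psi_Phi_act W hW
  refine (congrArg f hG).trans ((hf.2 _ _).trans ?_)
  rw [detWeight_one, one_mul]

noncomputable def equivSI (a : Fin m → ℕ) (b : Fin n → ℕ) (N : ℕ) :
    (Tquiv m p n).SIw (betaHat m p n) (sigmaHat m p n a b N) ≃ₗ[ℂ]
    (Squiv m p n).SIw (betaS m p n) (sigmaS m p n a b N) where
  toFun f := ⟨fun X => f.1 (Psi X), f.2.1.comp Psi Psi_poly, fun g W => by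
    obtain ⟨X, H, Y, rfl⟩ := exSG g
    obtain ⟨H, rfl⟩ := (re m p).surjective H
    refine (congrArg f.1 (Psi_act X H Y W)).trans ((f.2.2 _ _).trans ?_)
    rw [detWeight_eq]⟩
  invFun F := ⟨fun W => F.1 (Phi W), F.2.1.comp Phi Phi_poly, fun g W => by
    obtain ⟨X, G, H, Y, rfl⟩ := exTG g
    refine (congrArg F.1 (Phi_act X G H Y W)).trans ((F.2.2 _ _).trans ?_)
    rw [detWeight_eq]⟩
  map_add' _ _ := rfl
  map_smul' _ _ := rfl
  left_inv f := Subtype.ext (Psi_Phi_eq a b N f.1 f.2)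
  right_inv F := Subtype.ext (by funext X; exact congrArg F.1 (Phi_Psi X))

end TS

theorem siDim_T_eq_siDim_S
    (m n p : ℕ) (hm : 0 < m) (hn : 0 < n) (hp : 0 < p)
    (a : Fin m → ℕ) (b : Fin n → ℕ) (N : ℕ)
    (hNa : N = ∑ i : Fin m, a i) (hNb : N = ∑ j : Fin n, b j) :
    (Tquiv m p n).siDim (betaHat m p n) (sigmaHat m p n a b N) =
      (Squiv m p n).siDim (betaS m p n) (sigmaS m p n a b N) :=
  (TS.equivSI a b N).finrank_eq
end

section
/- With margin vectors a ∈ ℕ^m, b ∈ ℕ^n satisfying N = Σ a_i = Σ b_j, the number of 3-way contingency tables equals the dimension of the weight space of semi-invariants of the star quiver: T_{a,b} = dim_ℂ SI(𝒮, β)_{σ_{a,b}}. -/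
namespace StarProof

open Matrix

variable {m n p : ℕ}

abbrev R (m p n : ℕ) := (Squiv m p n).Rep (betaS m p n)
abbrev G (m p n : ℕ) := (Squiv m p n).GLb (betaS m p n)

def WX (W : R m p n) (l : Fin (m + p)) :
    Matrix (Fin (m * p)) (Fin (betaS m p n (.x l))) ℂ := W (Sum.inl l)
def WY (W : R m p n) (j : Fin n) : Matrix (Fin 1) (Fin (m * p)) ℂ := W (Sum.inr j)
def GX (g : G m p n) (l : Fin (m + p)) :
    (Matrix (Fin (betaS m p n (.x l))) (Fin (betaS m p n (.x l))) ℂ)ˣ := g (.x l)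
def GZ (g : G m p n) : (Matrix (Fin (m * p)) (Fin (m * p)) ℂ)ˣ := g .z0
def GY (g : G m p n) (j : Fin n) : (Matrix (Fin 1) (Fin 1) ℂ)ˣ := g (.y j)

lemma WX_act (g : G m p n) (W : R m p n) (l : Fin (m + p)) :
    WX ((Squiv m p n).invAct g W) l = ((GZ g)⁻¹).val * WX W l * (GX g l).val := rfl
lemma WY_act (g : G m p n) (W : R m p n) (j : Fin n) :
    WY ((Squiv m p n).invAct g W) j = ((GY g j)⁻¹).val * WY W j * (GZ g).val := rfl

lemma rep_ext {W W' : R m p n} (h1 : ∀ l, WX W l = WX W' l) (h2 : ∀ j, WY W j = WY W' j) :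
    W = W' := by
  funext a
  rcases a with l | j
  · exact h1 l
  · exact h2 j

def mkR (X : ∀ l, Matrix (Fin (m * p)) (Fin (betaS m p n (.x l))) ℂ)
    (Y : Fin n → Matrix (Fin 1) (Fin (m * p)) ℂ) : R m p n
  | Sum.inl l => X l
  | Sum.inr j => Y j

def mkG (X : ∀ l, (Matrix (Fin (betaS m p n (.x l))) (Fin (betaS m p n (.x l))) ℂ)ˣ)
    (Z : (Matrix (Fin (m * p)) (Fin (m * p)) ℂ)ˣ)
    (Y : Fin n → (Matrix (Fin 1) (Fin 1) ℂ)ˣ) : G m p n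
  | .x l => X l
  | .z0 => Z
  | .y j => Y j

lemma beta_left (n : ℕ) (i : Fin m) : 1 = betaS m p n (.x (Fin.castAdd p i)) := by
  simp [betaS]
lemma beta_right (n : ℕ) (k : Fin p) : m = betaS m p n (.x (Fin.natAdd m k)) := by
  simp [betaS]

def el (n : ℕ) (i : Fin m) : Fin 1 ≃ Fin (betaS m p n (.x (Fin.castAdd p i))) :=
  finCongr (beta_left n i)
def er (n : ℕ) (k : Fin p) : Fin m ≃ Fin (betaS m p n (.x (Fin.natAdd m k))) :=
  finCongr (beta_right n k)
def ez : Fin m × Fin p ≃ Fin (m * p) := finProdFinEquiv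

/-- concrete components -/
def Vm (W : R m p n) : Matrix (Fin m × Fin p) (Fin m) ℂ :=
  fun z i => WX W (Fin.castAdd p i) (ez z) (el n i 0)
def Bm (W : R m p n) : Matrix (Fin m × Fin p) (Fin m × Fin p) ℂ :=
  fun z y => WX W (Fin.natAdd m y.2) (ez z) (er n y.2 y.1)
def Cm (W : R m p n) : Matrix (Fin n) (Fin m × Fin p) ℂ :=
  fun j z => WY W j 0 (ez z)

def mkX (V : Matrix (Fin m × Fin p) (Fin m) ℂ) (B : Matrix (Fin m × Fin p) (Fin m × Fin p) ℂ)
    (l : Fin (m + p)) : Matrix (Fin (m * p)) (Fin (betaS m p n (.x l))) ℂ :=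
  Fin.addCases (motive := fun l => Matrix (Fin (m * p)) (Fin (betaS m p n (.x l))) ℂ)
    (fun i => Matrix.of fun z _ => V (ez.symm z) i)
    (fun k => Matrix.of fun z y => B (ez.symm z) ((er n k).symm y, k)) l

lemma mkX_left (V : Matrix (Fin m × Fin p) (Fin m) ℂ) (B) (i : Fin m) (z y) :
    mkX (n := n) V B (Fin.castAdd p i) z y = V (ez.symm z) i := by
  unfold mkX
  rw [Fin.addCases_left]
  rfl

lemma mkX_right (V : Matrix (Fin m × Fin p) (Fin m) ℂ) (B) (k : Fin p) (z y) :
    mkX (n := n) V B (Fin.natAdd m k) z y = B (ez.symm z) ((er n k).symm y, k) := by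
  unfold mkX
  rw [Fin.addCases_right]
  rfl

def mk (V : Matrix (Fin m × Fin p) (Fin m) ℂ) (B : Matrix (Fin m × Fin p) (Fin m × Fin p) ℂ)
    (C : Matrix (Fin n) (Fin m × Fin p) ℂ) : R m p n :=
  mkR (mkX V B) (fun j => Matrix.of fun _ z => C j (ez.symm z))

lemma Vm_mk (V B) (C : Matrix (Fin n) (Fin m × Fin p) ℂ) : Vm (mk V B C) = V := by
  ext z i
  refine (mkX_left V B i (ez z) (el n i 0)).trans ?_
  rw [Equiv.symm_apply_apply]
lemma Bm_mk (V B) (C : Matrix (Fin n) (Fin m × Fin p) ℂ) : Bm (mk V B C) = B := by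
  ext z i
  refine (mkX_right V B i.2 (ez z) (er n i.2 i.1)).trans ?_
  rw [Equiv.symm_apply_apply, Equiv.symm_apply_apply]
lemma Cm_mk (V B) (C : Matrix (Fin n) (Fin m × Fin p) ℂ) : Cm (mk V B C) = C := by
  ext z i
  change C z (ez.symm (ez i)) = _
  rw [Equiv.symm_apply_apply]

lemma ext3 {W W' : R m p n} (h1 : Vm W = Vm W') (h2 : Bm W = Bm W') (h3 : Cm W = Cm W') :
    W = W' := by
  apply rep_ext
  · intro l
    refine Fin.addCases (fun i => ?_) (fun k => ?_) l
    · ext z y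
      obtain ⟨z, rfl⟩ := ez.surjective z
      obtain ⟨y, rfl⟩ := (el n i).surjective y
      obtain rfl : y = 0 := Subsingleton.elim _ _
      exact congrFun (congrFun h1 z) i
    · ext z y
      obtain ⟨z, rfl⟩ := ez.surjective z
      obtain ⟨y, rfl⟩ := (er n k).surjective y
      exact congrFun (congrFun h2 z) (y, k)
  · intro j
    ext y z
    obtain ⟨z, rfl⟩ := ez.surjective z
    obtain rfl : y = 0 := Subsingleton.elim _ _
    exact congrFun (congrFun h3 j) z

/-- group components -/
noncomputable def gx (g : G m p n) (i : Fin m) : ℂˣ :=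
  Units.map Matrix.detMonoidHom (GX g (Fin.castAdd p i))
noncomputable def gy (g : G m p n) (j : Fin n) : ℂˣ :=
  Units.map Matrix.detMonoidHom (GY g j)
noncomputable def gh (g : G m p n) : (Matrix (Fin m × Fin p) (Fin m × Fin p) ℂ)ˣ :=
  Units.map (Matrix.reindexAlgEquiv ℂ ℂ (ez (m := m) (p := p)).symm).toMonoidHom (GZ g)
noncomputable def gk (g : G m p n) (k : Fin p) : (Matrix (Fin m) (Fin m) ℂ)ˣ :=
  Units.map (Matrix.reindexAlgEquiv ℂ ℂ (er n k).symm).toMonoidHom (GX g (Fin.natAdd m k))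

lemma gh_apply (g : G m p n) (y z) : (gh g).val y z = (GZ g).val (ez y) (ez z) := rfl
lemma ghi_apply (g : G m p n) (y z) :
    ((gh g)⁻¹).val y z = ((GZ g)⁻¹).val (ez y) (ez z) := rfl
lemma gk_apply (g : G m p n) (k y z) :
    (gk g k).val y z = (GX g (Fin.natAdd m k)).val (er n k y) (er n k z) := rfl
lemma gx_apply (g : G m p n) (i) :
    (GX g (Fin.castAdd p i)).val (el n i 0) (el n i 0) = gx g i := by
  have : Subsingleton (Fin (betaS m p n (.x (Fin.castAdd p i)))) := (el n i).symm.subsingleton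
  exact (Matrix.det_eq_elem_of_subsingleton _ _).symm
lemma gyi_apply (g : G m p n) (j) :
    ((GY g j)⁻¹).val 0 0 = ((gy g j)⁻¹ : ℂˣ) := by
  rw [gy, ← map_inv]
  exact (Matrix.det_eq_elem_of_subsingleton ((GY g j)⁻¹).val 0).symm

lemma Vm_act (g : G m p n) (W : R m p n) : Vm ((Squiv m p n).invAct g W) =
    ((gh g)⁻¹).val * Vm W * diagonal (fun i => ((gx g i : ℂˣ) : ℂ)) := by
  ext z i
  have : Subsingleton (Fin (betaS m p n (.x (Fin.castAdd p i)))) := (el n i).symm.subsingleton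
  rw [Matrix.mul_diagonal, Vm, WX_act, Matrix.mul_apply, Fintype.sum_subsingleton _ (el n i 0),
    gx_apply, Matrix.mul_apply, Matrix.mul_apply]
  congr 1
  exact (Fintype.sum_equiv ez _ _ (fun y => rfl)).symm

lemma Bm_act (g : G m p n) (W : R m p n) : Bm ((Squiv m p n).invAct g W) =
    ((gh g)⁻¹).val * Bm W * blockDiagonal (fun k => (gk g k).val) := by
  ext z ⟨i, k⟩
  rw [Bm, WX_act, Matrix.mul_apply, Matrix.mul_apply, Fintype.sum_prod_type]
  simp only [blockDiagonal_apply, mul_ite, mul_zero, Finset.sum_ite_eq', Finset.mem_univ, if_true]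
  refine (Fintype.sum_equiv (er n k) _ _ (fun y => ?_)).symm
  rw [gk_apply]
  congr 1
  rw [Matrix.mul_apply, Matrix.mul_apply]
  exact (Fintype.sum_equiv ez _ _ (fun y => rfl))

lemma Cm_act (g : G m p n) (W : R m p n) : Cm ((Squiv m p n).invAct g W) =
    diagonal (fun j => (((gy g j)⁻¹ : ℂˣ) : ℂ)) * Cm W * (gh g).val := by
  ext j z
  rw [Cm, WY_act, Matrix.mul_apply, Matrix.mul_apply]
  refine (Fintype.sum_equiv ez _ _ (fun y => ?_)).symm
  rw [Matrix.diagonal_mul, gh_apply]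
  congr 1
  rw [Matrix.mul_apply, Fintype.sum_subsingleton _ 0, gyi_apply]
  rfl

noncomputable def gmk (t : Fin m → ℂˣ) (s : Fin n → ℂˣ)
    (h : (Matrix (Fin m × Fin p) (Fin m × Fin p) ℂ)ˣ)
    (k : Fin p → (Matrix (Fin m) (Fin m) ℂ)ˣ) : G m p n :=
  mkG (fun l => Fin.addCases (motive := fun l =>
      (Matrix (Fin (betaS m p n (.x l))) (Fin (betaS m p n (.x l))) ℂ)ˣ)
    (fun i => Units.map (Matrix.scalar _).toMonoidHom (t i))
    (fun κ => Units.map (Matrix.reindexAlgEquiv ℂ ℂ (er n κ)).toMonoidHom (k κ)) l)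
    (Units.map (Matrix.reindexAlgEquiv ℂ ℂ (ez (m := m) (p := p))).toMonoidHom h)
    (fun j => Units.map (Matrix.scalar _).toMonoidHom (s j))

lemma gx_gmk (t : Fin m → ℂˣ) (s : Fin n → ℂˣ) (h) (k : Fin p → (Matrix (Fin m) (Fin m) ℂ)ˣ)
    (i) : gx (gmk t s h k) i = t i := by
  ext
  rw [← gx_apply]
  simp [GX, gmk, mkG, Fin.addCases_left]
lemma gy_gmk (t : Fin m → ℂˣ) (s : Fin n → ℂˣ) (h) (k : Fin p → (Matrix (Fin m) (Fin m) ℂ)ˣ)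
    (i) : gy (gmk t s h k) i = s i := by
  ext
  simp [gy, GY, gmk, mkG]
lemma gh_gmk (t : Fin m → ℂˣ) (s : Fin n → ℂˣ) (h) (k : Fin p → (Matrix (Fin m) (Fin m) ℂ)ˣ) :
    gh (gmk t s h k) = h := by
  ext y z
  rw [gh_apply]
  simp [GZ, gmk, mkG]
lemma gk_gmk (t : Fin m → ℂˣ) (s : Fin n → ℂˣ) (h) (k : Fin p → (Matrix (Fin m) (Fin m) ℂ)ˣ)
    (i) : gk (gmk t s h k) i = k i := by
  ext y z
  rw [gk_apply]
  simp [GX, gmk, mkG, Fin.addCases_right]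

def vertEquiv : Fin (m + p) ⊕ Unit ⊕ Fin n ≃ SVert m p n where
  toFun := Sum.elim SVert.x (Sum.elim (fun _ => SVert.z0) SVert.y)
  invFun
    | .x l => Sum.inl l
    | .z0 => Sum.inr (Sum.inl ())
    | .y j => Sum.inr (Sum.inr j)
  left_inv := by rintro (_ | _ | _) <;> rfl
  right_inv := by rintro (_ | _ | _) <;> rfl

lemma detWeight_eq (a : Fin m → ℕ) (b : Fin n → ℕ) (N : ℕ) (g : G m p n) :
    (Squiv m p n).detWeight (sigmaS m p n a b N) g =
    ((∏ i, (gx g i : ℂ) ^ a i) * ∏ k, ((gk g k).val.det) ^ N) *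
      (((gh g)⁻¹.val.det) ^ N * ∏ j, (((gy g j)⁻¹ : ℂˣ) : ℂ) ^ b j) := by
  have h0 : (Squiv m p n).detWeight (sigmaS m p n a b N) g =
      ∏ x : SVert m p n, (Matrix.det (g x).val) ^ (sigmaS m p n a b N x) := rfl
  rw [h0, ← Fintype.prod_equiv vertEquiv
    (fun x => (Matrix.det (g (vertEquiv x)).val) ^ (sigmaS m p n a b N (vertEquiv x))) _
    (fun x => rfl), Fintype.prod_sum_type, Fintype.prod_sum_type, Fin.prod_univ_add]
  congr 1
  · congr 1
    · refine Finset.prod_congr rfl fun i _ => ?_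
      simp only [vertEquiv, Equiv.coe_fn_mk, Sum.elim_inl, sigmaS, Fin.val_castAdd, Fin.is_lt,
        dif_pos, zpow_natCast]
      rfl
    · refine Finset.prod_congr rfl fun k _ => ?_
      have : (gk g k).val.det = (GX g (Fin.natAdd m k)).val.det :=
        Matrix.det_submatrix_equiv_self (er n k) _
      rw [this]
      simp only [vertEquiv, Equiv.coe_fn_mk, Sum.elim_inl, sigmaS, Fin.val_natAdd]
      rw [dif_neg (by omega), zpow_natCast]
      rfl
  · congr 1
    · have : (gh g)⁻¹.val.det = ((GZ g)⁻¹).val.det :=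
        Matrix.det_submatrix_equiv_self ez _
      rw [this, Matrix.coe_units_inv, Matrix.det_nonsing_inv, Ring.inverse_eq_inv', inv_pow]
      simp only [vertEquiv, Equiv.coe_fn_mk, Sum.elim_inl, Sum.elim_inr, sigmaS,
        Finset.univ_unique, Finset.prod_singleton, _root_.zpow_neg, zpow_natCast]
      rfl
    · refine Finset.prod_congr rfl fun j _ => ?_
      simp only [vertEquiv, Equiv.coe_fn_mk, Sum.elim_inr, sigmaS, _root_.zpow_neg, zpow_natCast,
        Units.val_inv_eq_inv_val, inv_pow]
      rfl

/-- The algebra of polynomial functions. -/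
def polyAlg (Q : FinQuiver) (β : Q.V → ℕ) : Subalgebra ℂ (Q.Rep β → ℂ) where
  carrier := {f | Q.IsPolyFun f}
  mul_mem' := by
    rintro f g ⟨P, hP⟩ ⟨P', hP'⟩
    exact ⟨P * P', fun W => by simp [hP, hP']⟩
  add_mem' := by
    rintro f g ⟨P, hP⟩ ⟨P', hP'⟩
    exact ⟨P + P', fun W => by simp [hP, hP']⟩
  algebraMap_mem' := by
    intro r
    exact ⟨MvPolynomial.C r, fun W => by simp⟩

lemma coord_mem (Q : FinQuiver) (β : Q.V → ℕ) (a : Q.A) (i j) :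
    (fun W : Q.Rep β => W a i j) ∈ polyAlg Q β :=
  ⟨MvPolynomial.X ⟨a, i, j⟩, fun W => by simp⟩

def PolyMat {ι κ : Type} (M : R m p n → Matrix ι κ ℂ) : Prop :=
  ∀ i j, (fun W => M W i j) ∈ polyAlg (Squiv m p n) (betaS m p n)

lemma PolyMat.mul {ι κ τ : Type} [Fintype κ] {M : R m p n → Matrix ι κ ℂ}
    {M' : R m p n → Matrix κ τ ℂ} (h : PolyMat M) (h' : PolyMat M') :
    PolyMat (fun W => M W * M' W) := by
  intro i j
  have : (fun W => (M W * M' W) i j) = ∑ l, (fun W => M W i l) * (fun W => M' W l j) := by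
    ext W
    simp [Matrix.mul_apply]
  rw [this]
  exact sum_mem fun l _ => mul_mem (h i l) (h' l j)

lemma poly_const (c : ℂ) : (fun _ => c) ∈ polyAlg (Squiv m p n) (betaS m p n) :=
  (polyAlg (Squiv m p n) (betaS m p n)).algebraMap_mem c

lemma PolyMat.const {ι κ : Type} (M : Matrix ι κ ℂ) :
    PolyMat (fun _ : R m p n => M) := fun i j => poly_const (M i j)

lemma PolyMat.det {ι : Type} [Fintype ι] [DecidableEq ι] {M : R m p n → Matrix ι ι ℂ}
    (h : PolyMat M) : (fun W => (M W).det) ∈ polyAlg (Squiv m p n) (betaS m p n) := by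
  have : (fun W => (M W).det) = ∑ σ : Equiv.Perm ι, (fun _ => ((Equiv.Perm.sign σ : ℤ) : ℂ)) *
      ∏ i, (fun W => M W (σ i) i) := by
    ext W
    simp [Matrix.det_apply']
  rw [this]
  exact sum_mem fun σ _ => mul_mem (poly_const _) (prod_mem fun i _ => h _ _)

lemma PolyMat.adjugate {ι : Type} [Fintype ι] [DecidableEq ι] {M : R m p n → Matrix ι ι ℂ}
    (h : PolyMat M) : PolyMat (fun W => (M W).adjugate) := by
  intro i j
  simp only [Matrix.adjugate_apply]
  apply PolyMat.det
  intro k l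
  simp only [Matrix.updateRow_apply]
  split_ifs
  · exact poly_const _
  · exact h _ _

lemma poly_Vm : PolyMat (Vm (m := m) (p := p) (n := n)) := fun z i =>
  coord_mem (Squiv m p n) (betaS m p n) (Sum.inl (Fin.castAdd p i)) (ez z) (el n i 0)
lemma poly_Bm : PolyMat (Bm (m := m) (p := p) (n := n)) := fun z y =>
  coord_mem (Squiv m p n) (betaS m p n) (Sum.inl (Fin.natAdd m y.2)) (ez z) (er n y.2 y.1)
lemma poly_Cm : PolyMat (Cm (m := m) (p := p) (n := n)) := fun j z =>
  coord_mem (Squiv m p n) (betaS m p n) (Sum.inr j) (0 : Fin 1) (ez z)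

/-- projector on the `k`-th block -/
def E (m : ℕ) {p : ℕ} (k : Fin p) : Matrix (Fin m × Fin p) (Fin m × Fin p) ℂ :=
  diagonal (fun z => if z.2 = k then 1 else 0)

lemma bd_mul_E (g : Fin p → Matrix (Fin m) (Fin m) ℂ) (k : Fin p) :
    blockDiagonal g * E m k = E m k * blockDiagonal g := by
  ext ⟨i, k1⟩ ⟨j, k2⟩
  rw [E, Matrix.mul_diagonal, Matrix.diagonal_mul]
  simp only [blockDiagonal_apply]
  split_ifs <;> simp_all

noncomputable def U (k : Fin p) (W : R m p n) : Matrix (Fin n) (Fin m) ℂ :=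
  Cm W * Bm W * E m k * (Bm W).adjugate * Vm W

lemma poly_U (k : Fin p) : PolyMat (U (m := m) (n := n) k) :=
  (((poly_Cm.mul poly_Bm).mul (PolyMat.const _)).mul poly_Bm.adjugate).mul poly_Vm

lemma U_act (k : Fin p) (g : G m p n) (W : R m p n) (j : Fin n) (i : Fin m) :
    U k ((Squiv m p n).invAct g W) j i =
    ((((gy g j)⁻¹ : ℂˣ) : ℂ) * (gx g i : ℂ) * ((∏ k, (gk g k).val.det) * ((gh g)⁻¹).val.det)) *
      U k W j i := by
  set D := blockDiagonal (fun k => (gk g k).val) with hD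
  set H := (gh g).val
  set H' := ((gh g)⁻¹).val
  have hH : H * H' = 1 := (gh g).mul_inv
  have key : U k ((Squiv m p n).invAct g W) =
      diagonal (fun j => (((gy g j)⁻¹ : ℂˣ) : ℂ)) *
      ((D.det * H'.det) • U k W) * diagonal (fun i => ((gx g i : ℂˣ) : ℂ)) := by
    rw [U, Vm_act, Bm_act, Cm_act, Matrix.adjugate_mul_distrib, Matrix.adjugate_mul_distrib]
    set X := diagonal (fun j => (((gy g j)⁻¹ : ℂˣ) : ℂ))
    set Y := diagonal (fun i => ((gx g i : ℂˣ) : ℂ))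
    calc X * Cm W * H * (H' * Bm W * D) * E m k * (D.adjugate * ((Bm W).adjugate * H'.adjugate))
          * (H' * Vm W * Y)
        = X * Cm W * (H * H') * Bm W * (D * E m k) * D.adjugate * (Bm W).adjugate *
          (H'.adjugate * H') * Vm W * Y := by simp only [Matrix.mul_assoc]
      _ = X * Cm W * Bm W * E m k * (D * D.adjugate) * (Bm W).adjugate *
          (H'.adjugate * H') * Vm W * Y := by
            rw [hH, hD, bd_mul_E]; simp only [Matrix.mul_assoc, Matrix.one_mul]
      _ = _ := by
        rw [Matrix.mul_adjugate, Matrix.adjugate_mul, U]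
        simp only [Matrix.mul_smul, Matrix.smul_mul, Matrix.mul_one, Matrix.mul_assoc, smul_smul]
        rw [mul_comm]
  rw [key, Matrix.mul_diagonal, Matrix.diagonal_mul, hD, Matrix.det_blockDiagonal,
    Matrix.smul_apply, smul_eq_mul]
  ring

/-- The monomial semi-invariants. -/
noncomputable def F (x : Fin m × Fin n × Fin p → ℕ) (W : R m p n) : ℂ :=
  ∏ q, (U q.2.2 W q.2.1 q.1) ^ x q

lemma prod_margin {ι κ τ : Type} [Fintype ι] [Fintype κ] [Fintype τ]
    (x : ι × κ × τ → ℕ) (a : ι → ℕ) (b : κ → ℕ)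
    (ha : ∀ i, ∑ j, ∑ k, x (i, j, k) = a i) (hb : ∀ j, ∑ i, ∑ k, x (i, j, k) = b j)
    (t : ι → ℂ) (s : κ → ℂ) :
    ∏ q, (s q.2.1 * t q.1) ^ x q = (∏ i, t i ^ a i) * ∏ j, s j ^ b j := by
  simp only [mul_pow, Finset.prod_mul_distrib]
  rw [mul_comm]
  congr 1
  · rw [Fintype.prod_prod_type]
    refine Finset.prod_congr rfl fun i _ => ?_
    rw [← ha, Fintype.prod_prod_type]
    simp only [Finset.prod_pow_eq_pow_sum]
  · rw [Fintype.prod_prod_type]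
    simp only [Fintype.prod_prod_type, Finset.prod_pow_eq_pow_sum]
    rw [Finset.prod_comm]
    refine Finset.prod_congr rfl fun i _ => ?_
    rw [← hb]
    simp only [Finset.prod_pow_eq_pow_sum]

lemma sum_margin {ι κ τ : Type} [Fintype ι] [Fintype κ] [Fintype τ]
    (x : ι × κ × τ → ℕ) (a : ι → ℕ)
    (ha : ∀ i, ∑ j, ∑ k, x (i, j, k) = a i) : ∑ q, x q = ∑ i, a i := by
  rw [Fintype.sum_prod_type]
  refine Finset.sum_congr rfl fun i _ => ?_
  rw [← ha, Fintype.sum_prod_type]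

def IsTab (a : Fin m → ℕ) (b : Fin n → ℕ) (x : Fin m × Fin n × Fin p → ℕ) : Prop :=
    (∀ i : Fin m, ∑ j : Fin n, ∑ k : Fin p, x (i, j, k) = a i) ∧
    (∀ j : Fin n, ∑ i : Fin m, ∑ k : Fin p, x (i, j, k) = b j)

lemma F_mem (a : Fin m → ℕ) (b : Fin n → ℕ) (N : ℕ) (hNa : N = ∑ i : Fin m, a i)
    (x : Fin m × Fin n × Fin p → ℕ) (hx : IsTab a b x) :
    F x ∈ (Squiv m p n).SIw (betaS m p n) (sigmaS m p n a b N) := by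
  constructor
  · have : (F x : R m p n → ℂ) = ∏ q, (fun W => U q.2.2 W q.2.1 q.1) ^ x q := by
      ext W
      simp [F]
    change F x ∈ polyAlg (Squiv m p n) (betaS m p n)
    rw [this]
    exact prod_mem fun q _ => pow_mem (poly_U _ _ _) _
  · intro g W
    simp only [F, U_act]
    simp only [mul_pow _ (U _ _ _ _), mul_pow _ ((∏ k, (gk g k).val.det) * _),
      Finset.prod_mul_distrib]
    rw [prod_margin x a b hx.1 hx.2 (fun i => (gx g i : ℂ)) (fun j => (((gy g j)⁻¹ : ℂˣ) : ℂ)),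
      Finset.prod_pow_eq_pow_sum, sum_margin x a hx.1, ← hNa, detWeight_eq, mul_pow,
      Finset.prod_pow]
    ring

/-- base point -/
def V0 (m p : ℕ) : Matrix (Fin m × Fin p) (Fin m) ℂ :=
  Matrix.of fun z i => if z.1 = i then 1 else 0

def sec (u : Fin m × Fin n × Fin p → ℂ) : R m p n :=
  mk (V0 m p) 1 (Matrix.of fun j z => u (z.1, j, z.2))

lemma Vm_sec (u : Fin m × Fin n × Fin p → ℂ) : Vm (sec u) = V0 m p := Vm_mk _ _ _
lemma Bm_sec (u : Fin m × Fin n × Fin p → ℂ) : Bm (sec u) = 1 := Bm_mk _ _ _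
lemma Cm_sec (u : Fin m × Fin n × Fin p → ℂ) :
    Cm (sec u) = Matrix.of fun j z => u (z.1, j, z.2) := Cm_mk _ _ _

lemma U_sec (u : Fin m × Fin n × Fin p → ℂ) (i j k) : U k (sec u) j i = u (i, j, k) := by
  rw [U, Vm_sec, Bm_sec, Cm_sec, Matrix.mul_one, Matrix.adjugate_one, Matrix.mul_one, E,
    Matrix.mul_apply]
  simp only [Matrix.mul_diagonal, V0, Matrix.of_apply, Fintype.sum_prod_type]
  simp

lemma F_sec (x : Fin m × Fin n × Fin p → ℕ) (u) : F x (sec u) = ∏ q, u q ^ x q := by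
  simp [F, U_sec]

lemma bd_V0 (M : Matrix (Fin m × Fin p) (Fin m) ℂ) :
    blockDiagonal (fun k => Matrix.of fun l i => M (l, k) i) * V0 m p = M := by
  ext ⟨l, k⟩ i
  simp [Matrix.mul_apply, Fintype.sum_prod_type, blockDiagonal_apply, V0]

noncomputable def blk (W : R m p n) (k : Fin p) : Matrix (Fin m) (Fin m) ℂ :=
  Matrix.of fun l i => ((Bm W).adjugate * Vm W) (l, k) i

noncomputable def Disc (W : R m p n) : ℂ := (Bm W).det * ∏ k, (blk W k).det

lemma poly_Disc : Disc ∈ polyAlg (Squiv m p n) (betaS m p n) := by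
  have : (Disc : R m p n → ℂ) = (fun W => (Bm W).det) * ∏ k, fun W => (blk W k).det := by
    ext W; simp [Disc]
  rw [this]
  refine mul_mem poly_Bm.det (prod_mem fun k _ => PolyMat.det fun l i => ?_)
  exact (poly_Bm.adjugate.mul poly_Vm) (l, k) i

lemma Disc_sec (u : Fin m × Fin n × Fin p → ℂ) : Disc (sec u) = 1 := by
  have : ∀ k, blk (sec u) k = 1 := by
    intro k
    ext l i
    rw [blk, Vm_sec, Bm_sec, Matrix.adjugate_one, Matrix.one_mul, V0, Matrix.one_apply]
    rfl
  rw [Disc, Finset.prod_congr rfl (fun k _ => by rw [this k]), Bm_sec]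
  simp

lemma inv_mul_eq {ι κ : Type} [Fintype ι] [DecidableEq ι] (h : (Matrix ι ι ℂ)ˣ)
    (X Y : Matrix ι κ ℂ) : (h⁻¹).val * X = Y ↔ X = h.val * Y := by
  constructor
  · rintro rfl
    rw [← Matrix.mul_assoc, Units.mul_inv, Matrix.one_mul]
  · rintro rfl
    rw [← Matrix.mul_assoc, Units.inv_mul, Matrix.one_mul]

lemma exists_sec (W : R m p n) (h : Disc W ≠ 0) :
    ∃ (g : G m p n) (u : _), (Squiv m p n).invAct g W = sec u := by
  rw [Disc, mul_ne_zero_iff, Finset.prod_ne_zero_iff] at h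
  obtain ⟨h1, h2⟩ := h
  let gs : Fin p → (Matrix (Fin m) (Fin m) ℂ)ˣ := fun k =>
    Matrix.nonsingInvUnit (blk W k) (isUnit_iff_ne_zero.2 (h2 k (Finset.mem_univ _)))
  have hdet : IsUnit (Bm W * blockDiagonal (blk W)).det := by
    rw [Matrix.det_mul, Matrix.det_blockDiagonal]
    exact isUnit_iff_ne_zero.2 (mul_ne_zero h1 (Finset.prod_ne_zero_iff.2 h2))
  let h := Matrix.nonsingInvUnit (Bm W * blockDiagonal (blk W)) hdet
  have hh : h.val = Bm W * blockDiagonal (blk W) := rfl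
  have hgs : blockDiagonal (fun k => (gs k).val) = blockDiagonal (blk W) := rfl
  refine ⟨gmk (fun _ => Units.mk0 _ h1) (fun _ => 1) h gs,
    fun q => (Cm W * h.val) q.2.1 (q.1, q.2.2), ext3 ?_ ?_ ?_⟩
  · rw [Vm_act, Vm_sec, gh_gmk]
    simp only [gx_gmk, Units.val_mk0]
    rw [Matrix.mul_assoc, inv_mul_eq, hh, Matrix.mul_assoc]
    have : blockDiagonal (blk W) * V0 m p = (Bm W).adjugate * Vm W :=
      bd_V0 ((Bm W).adjugate * Vm W)
    rw [this, ← Matrix.mul_assoc, Matrix.mul_adjugate]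
    ext i j
    simp [Matrix.mul_diagonal, mul_comm]
  · rw [Bm_act, Bm_sec, gh_gmk]
    simp only [gk_gmk]
    rw [Matrix.mul_assoc, hgs, ← hh, Units.inv_mul]
  · rw [Cm_act, Cm_sec, gh_gmk]
    simp only [gy_gmk, inv_one, Units.val_one, Matrix.diagonal_one, Matrix.one_mul]
    rfl

lemma detWeight_ne (a : Fin m → ℕ) (b : Fin n → ℕ) (N : ℕ) (g : G m p n) :
    (Squiv m p n).detWeight (sigmaS m p n a b N) g ≠ 0 := by
  refine Finset.prod_ne_zero_iff.2 fun x _ => zpow_ne_zero _ ?_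
  exact ((Matrix.isUnit_iff_isUnit_det _).1 (g x).isUnit).ne_zero

lemma eq_zero_of_sec (a : Fin m → ℕ) (b : Fin n → ℕ) (N : ℕ) (f : R m p n → ℂ)
    (hf : f ∈ (Squiv m p n).SIw (betaS m p n) (sigmaS m p n a b N))
    (h0 : ∀ u, f (sec u) = 0) : f = 0 := by
  obtain ⟨⟨P, hP⟩, hg⟩ := hf
  obtain ⟨D, hD⟩ := poly_Disc (m := m) (n := n) (p := p)
  have hmul : P * D = 0 := by
    apply MvPolynomial.funext
    intro w
    let W : R m p n := fun a i j => w ⟨a, i, j⟩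
    have e1 : MvPolynomial.eval w P = f W := (hP W).symm
    have e2 : MvPolynomial.eval w D = Disc W := (hD W).symm
    rw [map_mul, map_zero, e1, e2]
    by_cases hW : Disc W = 0
    · rw [hW, mul_zero]
    · obtain ⟨g, u, hu⟩ := exists_sec W hW
      have := hg g W
      rw [hu, h0] at this
      rw [(mul_eq_zero.1 this.symm).resolve_left (detWeight_ne a b N g), zero_mul]
  rcases mul_eq_zero.1 hmul with h | h
  · ext W
    rw [hP, h, map_zero]; rfl
  · have := hD (sec 0)
    rw [h, map_zero, Disc_sec] at this
    exact absurd this one_ne_zero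

/-- restriction to the section is polynomial -/
lemma poly_sec (f : R m p n → ℂ) (hf : (Squiv m p n).IsPolyFun f) :
    ∃ P : MvPolynomial (Fin m × Fin n × Fin p) ℂ, ∀ u, f (sec u) = MvPolynomial.eval u P := by
  obtain ⟨P, hP⟩ := hf
  have hc : ∀ q : ((a : (Squiv m p n).A) × (Fin (betaS m p n ((Squiv m p n).h a)) ×
      Fin (betaS m p n ((Squiv m p n).t a)))), ∃ S : MvPolynomial (Fin m × Fin n × Fin p) ℂ,
      ∀ u, (sec u : R m p n) q.1 q.2.1 q.2.2 = MvPolynomial.eval u S := by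
    rintro ⟨l | j, y, z⟩
    · refine ⟨MvPolynomial.C ((sec 0 : R m p n) (Sum.inl l) y z), fun u => ?_⟩
      rw [MvPolynomial.eval_C]
      rfl
    · refine ⟨MvPolynomial.X (((ez (m := m) (p := p)).symm z).1, j, (ez.symm z).2), fun u => ?_⟩
      rw [MvPolynomial.eval_X]
      rfl
  choose S hS using hc
  refine ⟨MvPolynomial.bind₁ S P, fun u => ?_⟩
  have h1 : MvPolynomial.eval u (MvPolynomial.bind₁ S P) =
      MvPolynomial.eval (fun q => MvPolynomial.eval u (S q)) P := by
    rw [MvPolynomial.eval, MvPolynomial.eval₂Hom_bind₁]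
    rfl
  rw [h1, hP]
  congr 2
  funext q
  exact hS q u

lemma coeff_scale {ι : Type} [Fintype ι] (w : ι → ℂ) (P : MvPolynomial ι ℂ) (d : ι →₀ ℕ) :
    (MvPolynomial.bind₁ (fun i => MvPolynomial.C (w i) * MvPolynomial.X i) P).coeff d =
      (∏ i, w i ^ d i) * P.coeff d := by
  classical
  induction P using MvPolynomial.induction_on' with
  | monomial e c =>
    have : MvPolynomial.bind₁ (fun i => MvPolynomial.C (w i) * MvPolynomial.X i)
        (MvPolynomial.monomial e c) = MvPolynomial.monomial e ((∏ i, w i ^ e i) * c) := by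
      rw [MvPolynomial.bind₁_monomial, MvPolynomial.monomial_eq, Finsupp.prod_fintype _ _ (by simp),
        ← Finsupp.prod, Finsupp.prod_fintype _ _ (by simp)]
      simp only [mul_pow, Finset.prod_mul_distrib, map_mul, map_prod, map_pow]
      ring
    rw [this, MvPolynomial.coeff_monomial, MvPolynomial.coeff_monomial]
    split_ifs with h
    · rw [h]
    · simp
  | add p q hp hq => rw [map_add, MvPolynomial.coeff_add, hp, hq, MvPolynomial.coeff_add]; ring

lemma sec_scale (a : Fin m → ℕ) (b : Fin n → ℕ) (N : ℕ) (f : R m p n → ℂ)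
    (hf : f ∈ (Squiv m p n).SIw (betaS m p n) (sigmaS m p n a b N))
    (t : Fin m → ℂˣ) (s : Fin n → ℂˣ) (u : _) :
    f (sec (fun q => (s q.2.1 : ℂ) * t q.1 * u q)) =
      ((∏ i, (t i : ℂ) ^ a i) * ∏ j, (s j : ℂ) ^ b j) * f (sec u) := by
  have hd : IsUnit (diagonal (fun i => (t i : ℂ))).det := by
    rw [Matrix.det_diagonal]
    exact isUnit_iff_ne_zero.2 (Finset.prod_ne_zero_iff.2 fun i _ => (t i).ne_zero)
  let D := Matrix.nonsingInvUnit (diagonal (fun i => (t i : ℂ))) hd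
  have hDv : D.val = diagonal (fun i => (t i : ℂ)) := rfl
  have hb : (blockDiagonal fun _ : Fin p => diagonal (fun i => (t i : ℂ))) =
      diagonal (fun z => (t z.1 : ℂ)) := Matrix.blockDiagonal_diagonal _
  have hd' : IsUnit (blockDiagonal fun _ : Fin p => D.val).det := by
    rw [Matrix.det_blockDiagonal]
    exact isUnit_iff_ne_zero.2 (Finset.prod_ne_zero_iff.2 fun i _ => hd.ne_zero)
  let h := Matrix.nonsingInvUnit _ hd'
  have hh : h.val = blockDiagonal fun _ : Fin p => D.val := rfl
  have hact : (Squiv m p n).invAct (gmk t s⁻¹ h (fun _ => D)) (sec u) =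
      sec (fun q => (s q.2.1 : ℂ) * t q.1 * u q) := by
    apply ext3
    · rw [Vm_act, Vm_sec, Vm_sec, gh_gmk]
      simp only [gx_gmk]
      rw [Matrix.mul_assoc, inv_mul_eq, hh, hDv, hb]
      ext z i
      rw [Matrix.mul_diagonal, Matrix.diagonal_mul, V0, Matrix.of_apply]
      split_ifs with hz
      · rw [hz]; ring
      · simp
    · rw [Bm_act, Bm_sec, Bm_sec, gh_gmk]
      simp only [gk_gmk]
      rw [Matrix.mul_one, ← hh, Units.inv_mul]
    · rw [Cm_act, Cm_sec, Cm_sec, gh_gmk]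
      simp only [gy_gmk, Pi.inv_apply, inv_inv]
      rw [hh, hDv, hb]
      ext j z
      rw [Matrix.mul_diagonal, Matrix.diagonal_mul, Matrix.of_apply, Matrix.of_apply]
      ring
  rw [← hact, hf.2, detWeight_eq]
  congr 1
  simp only [gx_gmk, gy_gmk, gk_gmk, gh_gmk, Pi.inv_apply, inv_inv]
  have h1 : (∏ k : Fin p, D.val.det ^ N) * (h⁻¹).val.det ^ N = 1 := by
    rw [Finset.prod_pow, ← mul_pow, ← Matrix.det_blockDiagonal, ← hh, ← Matrix.det_mul,
      Units.mul_inv, Matrix.det_one, one_pow]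
  linear_combination ((∏ i, (t i : ℂ) ^ a i) * ∏ j, (s j : ℂ) ^ b j) * h1

lemma two_pow_inj {x y : ℕ} (h : (2 : ℂ) ^ x = 2 ^ y) : x = y := by
  have : (2 : ℕ) ^ x = 2 ^ y := by exact_mod_cast h
  exact Nat.pow_right_injective le_rfl this

lemma prod_margin' (x : Fin m × Fin n × Fin p → ℕ) (t : Fin m → ℂ) (s : Fin n → ℂ) :
    ∏ q, (s q.2.1 * t q.1) ^ x q =
      (∏ i, t i ^ (∑ j, ∑ k, x (i, j, k))) * ∏ j, s j ^ (∑ i, ∑ k, x (i, j, k)) :=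
  prod_margin x _ _ (fun _ => rfl) (fun _ => rfl) t s

lemma coeff_tab (a : Fin m → ℕ) (b : Fin n → ℕ) (N : ℕ) (f : R m p n → ℂ)
    (hf : f ∈ (Squiv m p n).SIw (betaS m p n) (sigmaS m p n a b N))
    (P : MvPolynomial (Fin m × Fin n × Fin p) ℂ) (hP : ∀ u, f (sec u) = MvPolynomial.eval u P)
    (d : Fin m × Fin n × Fin p →₀ ℕ) (hd : P.coeff d ≠ 0) : IsTab a b d := by
  have key : ∀ (t : Fin m → ℂˣ) (s : Fin n → ℂˣ),
      (∏ i, (t i : ℂ) ^ (∑ j, ∑ k, d (i, j, k))) * ∏ j, (s j : ℂ) ^ (∑ i, ∑ k, d (i, j, k)) =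
      (∏ i, (t i : ℂ) ^ a i) * ∏ j, (s j : ℂ) ^ b j := by
    intro t s
    have h1 : MvPolynomial.bind₁ (fun q : Fin m × Fin n × Fin p =>
        MvPolynomial.C ((s q.2.1 : ℂ) * t q.1) * MvPolynomial.X q) P =
        MvPolynomial.C ((∏ i, (t i : ℂ) ^ a i) * ∏ j, (s j : ℂ) ^ b j) * P := by
      apply MvPolynomial.funext
      intro u
      rw [map_mul, MvPolynomial.eval_C, ← hP, ← sec_scale a b N f hf t s u, hP,
        MvPolynomial.eval, MvPolynomial.eval₂Hom_bind₁]
      congr 2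
      ext q
      simp
    have h2 := congrArg (MvPolynomial.coeff d) h1
    rw [coeff_scale, MvPolynomial.coeff_C_mul] at h2
    rw [← mul_right_cancel₀ hd h2]
    exact (prod_margin' d (fun i => (t i : ℂ)) (fun j => (s j : ℂ))).symm
  classical
  let two : ℂˣ := Units.mk0 2 two_ne_zero
  constructor
  · intro i
    have := key (Pi.mulSingle i two) 1
    simp only [Pi.one_apply, Units.val_one, one_pow, Finset.prod_const_one, mul_one] at this
    rw [Finset.prod_eq_single i, Finset.prod_eq_single i] at this
    · simp only [Pi.mulSingle_eq_same] at this
      exact two_pow_inj this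
    all_goals simp +contextual [Pi.mulSingle_eq_of_ne]
  · intro j
    have := key 1 (Pi.mulSingle j two)
    simp only [Pi.one_apply, Units.val_one, one_pow, Finset.prod_const_one, one_mul] at this
    rw [Finset.prod_eq_single j, Finset.prod_eq_single j] at this
    · simp only [Pi.mulSingle_eq_same] at this
      exact two_pow_inj this
    all_goals simp +contextual [Pi.mulSingle_eq_of_ne]

noncomputable def Fam (a : Fin m → ℕ) (b : Fin n → ℕ) (N : ℕ) (hNa : N = ∑ i : Fin m, a i)
    (x : {x : Fin m × Fin n × Fin p → ℕ // IsTab a b x}) :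
    (Squiv m p n).SIw (betaS m p n) (sigmaS m p n a b N) :=
  ⟨F x.1, F_mem a b N hNa x.1 x.2⟩

def res (S : Submodule ℂ (R m p n → ℂ)) : S →ₗ[ℂ] ((Fin m × Fin n × Fin p → ℂ) → ℂ) where
  toFun f := fun u => f.1 (sec u)
  map_add' _ _ := rfl
  map_smul' _ _ := rfl

noncomputable def evl (ι : Type) : MvPolynomial ι ℂ →ₗ[ℂ] ((ι → ℂ) → ℂ) where
  toFun P := fun u => MvPolynomial.eval u P
  map_add' _ _ := by ext; simp
  map_smul' _ _ := by ext; simp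

lemma linearIndependent_congr_aux {ι M : Type} [AddCommGroup M] [Module ℂ M] {v w : ι → M}
    (h : v = w) (hw : LinearIndependent ℂ w) : LinearIndependent ℂ v := h ▸ hw

lemma Fam_indep (a : Fin m → ℕ) (b : Fin n → ℕ) (N : ℕ) (hNa : N = ∑ i : Fin m, a i) :
    LinearIndependent ℂ (Fam (p := p) a b N hNa) := by
  apply LinearIndependent.of_comp (res _)
  have h1 : LinearIndependent ℂ (fun x : {x : Fin m × Fin n × Fin p → ℕ // IsTab a b x} =>
      MvPolynomial.monomial (R := ℂ) (Finsupp.equivFunOnFinite.symm x.1) 1) := by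
    have := (MvPolynomial.basisMonomials (Fin m × Fin n × Fin p) ℂ).linearIndependent.comp
      (fun x : {x : Fin m × Fin n × Fin p → ℕ // IsTab a b x} =>
        Finsupp.equivFunOnFinite.symm x.1)
      (Finsupp.equivFunOnFinite.symm.injective.comp Subtype.val_injective)
    simpa [Function.comp_def] using this
  have h2 := h1.map' (evl _) (LinearMap.ker_eq_bot.2 fun P Q h =>
    MvPolynomial.funext fun u => congrFun h u)
  refine (linearIndependent_congr_aux ?_ h2)
  ext x u
  simp only [Function.comp_apply, res, evl, Fam, LinearMap.coe_mk, AddHom.coe_mk, F_sec,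
    MvPolynomial.eval_monomial, one_mul]
  rw [Finsupp.prod_fintype _ _ (by simp)]
  rfl

lemma Fam_span (a : Fin m → ℕ) (b : Fin n → ℕ) (N : ℕ) (hNa : N = ∑ i : Fin m, a i) :
    ⊤ ≤ Submodule.span ℂ (Set.range (Fam (p := p) a b N hNa)) := by
  rintro ⟨f, hf⟩ -
  obtain ⟨P, hP⟩ := poly_sec f hf.1
  have htab := coeff_tab a b N f hf P hP
  let f' : (Squiv m p n).SIw (betaS m p n) (sigmaS m p n a b N) :=
    ∑ d : P.support, P.coeff d.1 •
      Fam a b N hNa ⟨d.1, htab d.1 (MvPolynomial.mem_support_iff.1 d.2)⟩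
  have hf' : (⟨f, hf⟩ : (Squiv m p n).SIw (betaS m p n) (sigmaS m p n a b N)) = f' := by
    rw [← sub_eq_zero]
    apply Subtype.ext
    apply eq_zero_of_sec a b N _ (Subtype.property _)
    intro u
    have e1 : f'.1 (sec u) = MvPolynomial.eval u P := by
      change res _ f' u = _
      simp only [f', map_sum, map_smul, Finset.sum_apply, Pi.smul_apply]
      rw [MvPolynomial.eval_eq',
        ← Finset.sum_coe_sort P.support (fun d => P.coeff d * ∏ i, u i ^ d i)]
      apply Finset.sum_congr rfl
      intro d _
      rw [smul_eq_mul]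
      congr 1
      exact F_sec _ u
    have e2 : ((⟨f, hf⟩ - f' : (Squiv m p n).SIw (betaS m p n) (sigmaS m p n a b N))).1 (sec u)
      = f (sec u) - f'.1 (sec u) := rfl
    rw [e2, e1, hP, sub_self]
  rw [hf']
  exact Submodule.sum_mem _ fun d _ => Submodule.smul_mem _ _ (Submodule.subset_span ⟨_, rfl⟩)

lemma main (a : Fin m → ℕ) (b : Fin n → ℕ) (N : ℕ) (hNa : N = ∑ i : Fin m, a i) :
    numTables m n p a b = (Squiv m p n).siDim (betaS m p n) (sigmaS m p n a b N) :=
  (Module.finrank_eq_nat_card_basis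
    (Module.Basis.mk (Fam_indep (p := p) a b N hNa) (Fam_span (p := p) a b N hNa))).symm

end StarProof

/-- The number of 3-way contingency tables equals the dimension of the
weight space of semi-invariants of the star quiver: `T_{a,b} = dim SI(𝒮, β)_{σ_{a,b}}`. -/
theorem numTables_eq_siDim_S
    (m n p : ℕ) (hm : 0 < m) (hn : 0 < n) (hp : 0 < p)
    (a : Fin m → ℕ) (b : Fin n → ℕ) (N : ℕ)
    (hNa : N = ∑ i : Fin m, a i) (hNb : N = ∑ j : Fin n, b j) :
    numTables m n p a b = (Squiv m p n).siDim (betaS m p n) (sigmaS m p n a b N) := by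
  exact StarProof.main a b N hNa
end
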